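/- arXiv:2106.11247 — 2 statements merged into one kernel-verified Lean document; each statement's English description precedes it below -/
import Mathlib

section
/- For every integer n ≥ 2 and every admissible ε such that the points of the moon 𝓛ₙ are in general position (no three collinear), the minimax result of the convex grabbing game on 𝓛ₙ satisfies M(𝓛ₙ) = n − 1 = R(𝓛ₙ); i.e., with optimal play Bob obtains all red points of the moon. -/
open scoped Classical

noncomputable section

/-- Determinant of the pair of vectors `(q - p, r - p)`. -/
def orientDet (p q r : ℝ × ℝ) : ℝ :=
  (q.1 - p.1) * (r.2 - p.2) - (q.2 - p.2) * (r.1 - p.1)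

/-- The orientation `∇ p q r` : `+1` for counterclockwise, `-1` for clockwise, `0` collinear. -/
def orient (p q r : ℝ × ℝ) : ℝ := Real.sign (orientDet p q r)

/-- A set of points is in general position if no three of its points are collinear. -/
def GenPos (C : Set (ℝ × ℝ)) : Prop :=
  ∀ p ∈ C, ∀ q ∈ C, ∀ r ∈ C, p ≠ q → p ≠ r → q ≠ r → orientDet p q r ≠ 0

/-- The extremal points of a finite set `C`. -/
def exPts (C : Finset (ℝ × ℝ)) : Finset (ℝ × ℝ) :=
  C.filter (fun c => c ∉ convexHull ℝ ((C.erase c : Finset (ℝ × ℝ)) : Set (ℝ × ℝ)))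

/-- The minimax value (Bob's total, Alice to move) of the convex grabbing game. -/
def gameM (w : ℝ × ℝ → ℕ) (C : Finset (ℝ × ℝ)) : ℕ :=
  if h : C.card ≤ 1 then 0
  else
    sInf (↑((exPts C).attach.image (fun a =>
      (exPts (C.erase a.1)).attach.sup (fun b =>
        w b.1 + gameM w ((C.erase a.1).erase b.1)))) : Set ℕ)
termination_by C.card
decreasing_by
  have ha : a.1 ∈ C := Finset.mem_of_mem_filter _ a.2
  have hb : b.1 ∈ C.erase a.1 := Finset.mem_of_mem_filter _ b.2
  calc ((C.erase a.1).erase b.1).card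
      < (C.erase a.1).card := Finset.card_erase_lt_of_mem hb
    _ ≤ C.card := Finset.card_erase_le

/-- The minimax value of the game when it is Bob's turn to move. -/
def gameMB (w : ℝ × ℝ → ℕ) (C : Finset (ℝ × ℝ)) : ℕ :=
  (exPts C).sup (fun b => w b + gameM w (C.erase b))


/-- The `j`-th green point of the moon with `n` rays. -/
def gPt (n j : ℕ) : ℝ × ℝ :=
  (Real.cos (j * Real.pi / n), -Real.sin (j * Real.pi / n))

/-- The `j`-th red point of the moon with `n` rays and parameter `ε`. -/
def rPt (n : ℕ) (ε : ℝ) (j : ℕ) : ℝ × ℝ :=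
  ((1 - ε) * Real.cos (j * Real.pi / n), -((1 - ε) * Real.sin (j * Real.pi / n)))

/-- The green points of the moon. -/
def moonGreens (n : ℕ) : Finset (ℝ × ℝ) := (Finset.range (n + 1)).image (gPt n)

/-- The red points of the moon. -/
def moonReds (n : ℕ) (ε : ℝ) : Finset (ℝ × ℝ) := (Finset.Icc 1 (n - 1)).image (rPt n ε)

/-- The point set of the moon `𝓛ₙ`. -/
def moonPts (n : ℕ) (ε : ℝ) : Finset (ℝ × ℝ) := moonGreens n ∪ moonReds n ε

/-- The weight function of the moon: red points have weight 1, everything else 0. -/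
def moonW (n : ℕ) (ε : ℝ) : ℝ × ℝ → ℕ := fun p => if p ∈ moonReds n ε then 1 else 0

/-- A point strictly separated, in the lexicographic order given by two linear functionals, from
the rest of a finite set is extremal. -/
lemma mem_exPts_of_lex {C : Finset (ℝ × ℝ)} {c : ℝ × ℝ} (hc : c ∈ C) (x y z t : ℝ)
    (h : ∀ p ∈ C, p ≠ c → x * c.1 + y * c.2 < x * p.1 + y * p.2 ∨
      (x * p.1 + y * p.2 = x * c.1 + y * c.2 ∧ z * c.1 + t * c.2 < z * p.1 + t * p.2)) :
    c ∈ exPts C := by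
  refine Finset.mem_filter.2 ⟨hc, fun hmem => ?_⟩
  have hconv : Convex ℝ {p : ℝ × ℝ | x * c.1 + y * c.2 < x * p.1 + y * p.2 ∨
      (x * p.1 + y * p.2 = x * c.1 + y * c.2 ∧ z * c.1 + t * c.2 < z * p.1 + t * p.2)} := by
    refine convex_iff_forall_pos.2 fun p hp q hq a b ha hb hab => ?_
    simp only [Set.mem_ofPred_eq, Prod.fst_add, Prod.snd_add, Prod.smul_fst, Prod.smul_snd,
      smul_eq_mul] at hp hq ⊢
    obtain rfl : b = 1 - a := by linarith
    rcases hp with hp | ⟨hp, hp'⟩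
    · left
      have hq0 : x * c.1 + y * c.2 ≤ x * q.1 + y * q.2 := by
        rcases hq with hq | ⟨hq, -⟩ <;> linarith
      nlinarith [mul_lt_mul_of_pos_left hp ha, mul_le_mul_of_nonneg_left hq0 hb.le]
    · rcases hq with hq | ⟨hq, hq'⟩
      · left
        nlinarith [mul_lt_mul_of_pos_left hq hb, congrArg (a * ·) hp]
      · right
        constructor
        · linear_combination a * hp + (1 - a) * hq
        · nlinarith [mul_lt_mul_of_pos_left hp' ha, mul_lt_mul_of_pos_left hq' hb]
  have hsub := convexHull_min (s := ((C.erase c : Finset (ℝ × ℝ)) : Set (ℝ × ℝ))) (fun p hp => by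
    have hp' := Finset.mem_erase.1 (Finset.mem_coe.1 hp)
    exact h p hp'.2 hp'.1) hconv hmem
  rcases hsub with h' | ⟨-, h'⟩ <;> exact lt_irrefl _ h'

/-- Bob never gets more than the total weight of the cake. -/
lemma gameM_le_sum (w : ℝ × ℝ → ℕ) (C : Finset (ℝ × ℝ)) : gameM w C ≤ ∑ c ∈ C, w c := by
  induction hk : C.card using Nat.strong_induction_on generalizing C with
  | _ k ih =>
    rw [gameM]
    split_ifs with h
    · exact Nat.zero_le _
    rcases (exPts C).attach.eq_empty_or_nonempty with he | ⟨a, ha⟩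
    · simp [he]
    refine (Nat.sInf_le (Finset.mem_coe.2 (Finset.mem_image_of_mem _ ha))).trans
      (Finset.sup_le fun b _ => ?_)
    have haC : a.1 ∈ C := Finset.mem_of_mem_filter _ a.2
    have hbC : b.1 ∈ C.erase a.1 := Finset.mem_of_mem_filter _ b.2
    have hlt : ((C.erase a.1).erase b.1).card < k := hk ▸
      (Finset.card_erase_lt_of_mem hbC).trans_le Finset.card_erase_le
    have := ih _ hlt _ rfl
    rw [← Finset.add_sum_erase _ _ haC, ← Finset.add_sum_erase _ _ hbC]
    omega

/-- If Bob has a good answer to every move of Alice, then the minimax result is large. -/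
lemma le_gameM (w : ℝ × ℝ → ℕ) {C : Finset (ℝ × ℝ)} {k : ℕ} (hC : 1 < C.card)
    (hne : (exPts C).Nonempty)
    (h : ∀ a ∈ exPts C, ∃ b ∈ exPts (C.erase a), k ≤ w b + gameM w ((C.erase a).erase b)) :
    k ≤ gameM w C := by
  rw [gameM, dif_neg hC.not_ge]
  refine le_csInf ?_ ?_
  · obtain ⟨a, ha⟩ := hne
    exact ⟨_, Finset.mem_coe.2 (Finset.mem_image_of_mem _ (Finset.mem_attach _ ⟨a, ha⟩))⟩
  · intro m hm
    obtain ⟨a, -, rfl⟩ := Finset.mem_image.1 (Finset.mem_coe.1 hm)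
    obtain ⟨b, hb, hk⟩ := h a.1 a.2
    exact hk.trans (Finset.le_sup (f := fun b : exPts (C.erase a.1) =>
      w b.1 + gameM w ((C.erase a.1).erase b.1)) (Finset.mem_attach _ ⟨b, hb⟩))

lemma pi_div_le_angle_sub {n j k : ℕ} (hn : 2 ≤ n) (h : j < k) :
    Real.pi / n ≤ k * Real.pi / n - j * Real.pi / n := by
  have hn0 : (0 : ℝ) < n := by positivity
  have h1 : (j : ℝ) + 1 ≤ k := by exact_mod_cast h
  rw [← sub_div]
  gcongr
  nlinarith [Real.pi_pos]

lemma angle_sub_le_pi {n j k : ℕ} (hn : 2 ≤ n) (h : k ≤ j + n) :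
    k * Real.pi / n - j * Real.pi / n ≤ Real.pi := by
  have hn0 : (0 : ℝ) < n := by positivity
  have h1 : (k : ℝ) ≤ j + n := by exact_mod_cast h
  rw [← sub_div, div_le_iff₀ hn0]
  nlinarith [Real.pi_pos]

lemma sin_angle_sub_pos {n j k : ℕ} (hn : 2 ≤ n) (h : j < k) (h' : k < j + n) :
    0 < Real.sin (k * Real.pi / n - j * Real.pi / n) := by
  have hn0 : (0 : ℝ) < n := by positivity
  refine Real.sin_pos_of_pos_of_lt_pi
    ((div_pos Real.pi_pos hn0).trans_le (pi_div_le_angle_sub hn h)) ?_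
  have h1 : (k : ℝ) < j + n := by exact_mod_cast h'
  rw [← sub_div, div_lt_iff₀ hn0]
  nlinarith [Real.pi_pos]

lemma cos_angle_sub_le {n j k : ℕ} (hn : 2 ≤ n) (hj : j ≤ n) (hk : k ≤ n) (h : j ≠ k) :
    Real.cos (k * Real.pi / n - j * Real.pi / n) ≤ Real.cos (Real.pi / n) := by
  have hn0 : (0 : ℝ) < n := by positivity
  have hpos := div_pos Real.pi_pos hn0
  rcases h.lt_or_gt with h | h
  · exact Real.cos_le_cos_of_nonneg_of_le_pi hpos.le (angle_sub_le_pi hn (by omega))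
      (pi_div_le_angle_sub hn h)
  · rw [← Real.cos_neg, neg_sub]
    exact Real.cos_le_cos_of_nonneg_of_le_pi hpos.le (angle_sub_le_pi hn (by omega))
      (pi_div_le_angle_sub hn h)

lemma cos_pi_div_nonneg {n : ℕ} (hn : 2 ≤ n) : 0 ≤ Real.cos (Real.pi / n) := by
  have h2 : (2 : ℝ) ≤ n := by exact_mod_cast hn
  refine Real.cos_nonneg_of_neg_pi_div_two_le_of_le ?_ ?_
  · have := Real.pi_pos
    have : 0 ≤ Real.pi / n := by positivity
    linarith
  · exact div_le_div_of_nonneg_left Real.pi_pos.le two_pos h2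

lemma cos_pi_div_lt_one {n : ℕ} (hn : 2 ≤ n) : Real.cos (Real.pi / n) < 1 := by
  have h2 : (1 : ℝ) ≤ n := by exact_mod_cast (by omega : 1 ≤ n)
  rw [← Real.cos_zero]
  refine Real.cos_lt_cos_of_nonneg_of_le_pi le_rfl ?_ (by positivity)
  exact div_le_self Real.pi_pos.le h2

lemma cos_pi_div_lt_of_admissible {n : ℕ} (hn : 2 ≤ n) {ε : ℝ}
    (hε1 : ε < 1 - Real.cos (Real.pi / (2 * n))) : Real.cos (Real.pi / n) < 1 - ε := by
  have h2 : (1 : ℝ) ≤ n := by exact_mod_cast (by omega : 1 ≤ n)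
  have h : Real.cos (Real.pi / n) ≤ Real.cos (Real.pi / (2 * n)) := by
    refine Real.cos_le_cos_of_nonneg_of_le_pi (by positivity) (div_le_self Real.pi_pos.le h2) ?_
    exact div_le_div_of_nonneg_left Real.pi_pos.le (by linarith) (by linarith)
  linarith

lemma gPt_inj {n j k : ℕ} (hn : 2 ≤ n) (hj : j ≤ n) (hk : k ≤ n) (h : gPt n j = gPt n k) :
    j = k := by
  by_contra hne
  have h1 := congrArg Prod.fst h
  have h2 := congrArg Prod.snd h
  simp only [gPt] at h1 h2
  have hc := cos_angle_sub_le hn hj hk hne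
  rw [Real.cos_sub, ← h1, ← neg_injective h2] at hc
  nlinarith [cos_pi_div_lt_one hn, Real.sin_sq_add_cos_sq (j * Real.pi / n)]

lemma rPt_inj {n j k : ℕ} {ε : ℝ} (hn : 2 ≤ n) (hε : 0 < 1 - ε) (hj : j ≤ n) (hk : k ≤ n)
    (h : rPt n ε j = rPt n ε k) : j = k := by
  refine gPt_inj hn hj hk ?_
  simpa [rPt, gPt, hε.ne'] using h

lemma gPt_ne_rPt {n j k : ℕ} {ε : ℝ} (hε : 0 < 1 - ε) (hε0 : 0 < ε) : gPt n j ≠ rPt n ε k := by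
  intro h
  have h1 := congrArg Prod.fst h
  have h2 := congrArg Prod.snd h
  simp only [gPt, rPt] at h1 h2
  have hj := Real.sin_sq_add_cos_sq (j * Real.pi / n)
  have hk := Real.sin_sq_add_cos_sq (k * Real.pi / n)
  rw [h1, neg_injective h2] at hj
  have : (1 - ε) ^ 2 = 1 := by linear_combination hj - (1 - ε) ^ 2 * hk
  nlinarith

/-- A sub-moon: the green points with indices `a`, `b` and in `I`, the red ones with indices
in `I`. -/
def subMoon (n : ℕ) (ε : ℝ) (a b : ℕ) (I : Finset ℕ) : Finset (ℝ × ℝ) :=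
  (insert a (insert b I)).image (gPt n) ∪ I.image (rPt n ε)

lemma mem_subMoon {n : ℕ} {ε : ℝ} {a b : ℕ} {I : Finset ℕ} {p : ℝ × ℝ} :
    p ∈ subMoon n ε a b I ↔
      (∃ k, (k = a ∨ k = b ∨ k ∈ I) ∧ gPt n k = p) ∨ ∃ k ∈ I, rPt n ε k = p := by
  simp only [subMoon, Finset.mem_union, Finset.mem_image, Finset.mem_insert]

/-- In a sub-moon, a red point lies in the triangle formed by its green neighbour and the two
end points. -/
lemma rPt_mem_convexHull {n : ℕ} {ε : ℝ} (hn : 2 ≤ n) (hε0 : 0 < ε)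
    (hε : Real.cos (Real.pi / n) < 1 - ε) {a j b : ℕ} (ha : a < j) (hj : j < b) (hb : b ≤ n)
    {S : Set (ℝ × ℝ)} (hSa : gPt n a ∈ S) (hSj : gPt n j ∈ S) (hSb : gPt n b ∈ S) :
    rPt n ε j ∈ convexHull ℝ S := by
  have hsa := sin_angle_sub_pos hn ha (by omega)
  have hsb := sin_angle_sub_pos hn hj (by omega)
  have hca := cos_angle_sub_le hn (by omega) (by omega) ha.ne
  have hcb := cos_angle_sub_le hn (by omega) (by omega) hj.ne
  set α := (j : ℝ) * Real.pi / n - a * Real.pi / n with hα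
  set β := (b : ℝ) * Real.pi / n - j * Real.pi / n with hβ
  have ea : (a : ℝ) * Real.pi / n = j * Real.pi / n - α := by rw [hα]; ring
  have eb : (b : ℝ) * Real.pi / n = j * Real.pi / n + β := by rw [hβ]; ring
  clear_value α β
  set c := Real.sin α * (1 - Real.cos β) + Real.sin β * (1 - Real.cos α) with hc
  have hcpos : 0 < c := add_pos (mul_pos hsa (by linarith)) (mul_pos hsb (by linarith))
  have hle : ε * (Real.sin α + Real.sin β) ≤ c := by
    nlinarith [mul_le_mul_of_nonneg_left (show ε ≤ 1 - Real.cos β by linarith) hsa.le,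
      mul_le_mul_of_nonneg_left (show ε ≤ 1 - Real.cos α by linarith) hsb.le]
  have hcomb : rPt n ε j = (ε * Real.sin β / c) • gPt n a + (ε * Real.sin α / c) • gPt n b +
      ((c - ε * (Real.sin α + Real.sin β)) / c) • gPt n j := by
    ext
    · simp only [rPt, gPt, Prod.fst_add, Prod.smul_fst, smul_eq_mul]
      rw [ea, eb, Real.cos_sub, Real.cos_add]
      field_simp
      rw [hc]
      ring
    · simp only [rPt, gPt, Prod.snd_add, Prod.smul_snd, smul_eq_mul]
      rw [ea, eb, Real.sin_sub, Real.sin_add]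
      field_simp
      rw [hc]
      ring
  rw [hcomb]
  have hconv := convex_convexHull ℝ S
  have hsum : ε * Real.sin β / c + ε * Real.sin α / c +
      (c - ε * (Real.sin α + Real.sin β)) / c = 1 := by
    field_simp
    ring
  have h3 := hconv.sum_mem (t := Finset.univ)
    (w := ![ε * Real.sin β / c, ε * Real.sin α / c, (c - ε * (Real.sin α + Real.sin β)) / c])
    (z := ![gPt n a, gPt n b, gPt n j])
    (by
      intro i _
      have := sub_nonneg.2 hle
      fin_cases i <;> simp <;> positivity)
    (by simpa [Fin.sum_univ_three] using hsum)
    (by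
      intro i _
      fin_cases i
      exacts [subset_convexHull ℝ S hSa, subset_convexHull ℝ S hSb, subset_convexHull ℝ S hSj])
  simpa [Fin.sum_univ_three] using h3

/-- Alice can only take green points of a sub-moon. -/
lemma exPts_subMoon {n : ℕ} {ε : ℝ} (hn : 2 ≤ n) (hε0 : 0 < ε)
    (hε : Real.cos (Real.pi / n) < 1 - ε) {a b : ℕ} {I : Finset ℕ} (hb : b ≤ n)
    (hI : ∀ j ∈ I, a < j ∧ j < b) {p : ℝ × ℝ} (hp : p ∈ exPts (subMoon n ε a b I)) :
    ∃ k, (k = a ∨ k = b ∨ k ∈ I) ∧ gPt n k = p := by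
  obtain ⟨hpC, hpe⟩ := Finset.mem_filter.1 hp
  rcases mem_subMoon.1 hpC with h | ⟨j, hj, rfl⟩
  · exact h
  · have hε' : 0 < 1 - ε := (cos_pi_div_nonneg hn).trans_lt hε
    have hmem : ∀ k, (k = a ∨ k = b ∨ k ∈ I) →
        gPt n k ∈ (((subMoon n ε a b I).erase (rPt n ε j) : Finset (ℝ × ℝ)) : Set (ℝ × ℝ)) :=
      fun k hk => Finset.mem_coe.2 (Finset.mem_erase.2
        ⟨gPt_ne_rPt hε' hε0, mem_subMoon.2 (Or.inl ⟨k, hk, rfl⟩)⟩)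
    exact absurd (rPt_mem_convexHull hn hε0 hε (hI j hj).1 (hI j hj).2 hb (hmem a (by simp))
      (hmem j (by simp [hj])) (hmem b (by simp))) hpe

/-- A point of the moon is extremal in any subset of the moon containing no other point with the
same index. -/
lemma mem_exPts_of_radial {n : ℕ} {ε : ℝ} (hn : 2 ≤ n) (hε0 : 0 < ε)
    (hε : Real.cos (Real.pi / n) < 1 - ε) {C : Finset (ℝ × ℝ)} {j : ℕ} {s : ℝ} (hj : j ≤ n)
    (hs : 1 - ε ≤ s) (hc : s • gPt n j ∈ C)
    (hC : ∀ p ∈ C, p ≠ s • gPt n j → (p = rPt n ε j ∧ 1 - ε < s) ∨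
      ∃ k ≤ n, k ≠ j ∧ (p = gPt n k ∨ p = rPt n ε k)) :
    s • gPt n j ∈ exPts C := by
  refine mem_exPts_of_lex hc 0 0 (-Real.cos (j * Real.pi / n)) (Real.sin (j * Real.pi / n))
    fun p hp hpc => Or.inr ⟨by ring, ?_⟩
  have h1 := Real.sin_sq_add_cos_sq (j * Real.pi / n)
  have h0 := cos_pi_div_nonneg hn
  have e : -Real.cos (j * Real.pi / n) * (s • gPt n j).1 +
      Real.sin (j * Real.pi / n) * (s • gPt n j).2 = -s := by
    simp only [gPt, Prod.smul_fst, Prod.smul_snd, smul_eq_mul]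
    linear_combination (-s) * h1
  rw [e]
  rcases hC p hp hpc with ⟨rfl, h⟩ | ⟨k, hk, hkj, rfl | rfl⟩
  · simp only [rPt]
    nlinarith
  · have := cos_angle_sub_le hn hj hk hkj.symm
    rw [Real.cos_sub] at this
    simp only [gPt]
    linarith
  · have := cos_angle_sub_le hn hj hk hkj.symm
    rw [Real.cos_sub] at this
    simp only [rPt]
    nlinarith

lemma rPt_eq_smul (n : ℕ) (ε : ℝ) (j : ℕ) : rPt n ε j = (1 - ε) • gPt n j := by
  simp [rPt, gPt]

/-- A red point is extremal in any set of points of the moon whose other points are its green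
neighbour and points on one fixed side (given by the sign `σ`) of the line through both. -/
lemma rPt_mem_exPts_of_side {n : ℕ} {ε : ℝ} (hε0 : 0 < ε) (hε : 0 < 1 - ε)
    {C : Finset (ℝ × ℝ)} {j : ℕ} (σ : ℝ) (hc : rPt n ε j ∈ C)
    (hC : ∀ p ∈ C, p ≠ rPt n ε j → p = gPt n j ∨
      ∃ k : ℕ, 0 < σ * Real.sin (k * Real.pi / n - j * Real.pi / n) ∧
        (p = gPt n k ∨ p = rPt n ε k)) :
    rPt n ε j ∈ exPts C := by
  refine mem_exPts_of_lex hc (-σ * Real.sin (j * Real.pi / n)) (-σ * Real.cos (j * Real.pi / n))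
    (Real.cos (j * Real.pi / n)) (-Real.sin (j * Real.pi / n)) fun p hp hpc => ?_
  have h1 := Real.sin_sq_add_cos_sq (j * Real.pi / n)
  rcases hC p hp hpc with rfl | ⟨k, hk, rfl | rfl⟩
  · refine Or.inr ⟨by simp only [gPt, rPt]; ring, ?_⟩
    simp only [gPt, rPt]
    nlinarith
  · left
    rw [Real.sin_sub] at hk
    simp only [gPt, rPt]
    nlinarith
  · left
    rw [Real.sin_sub] at hk
    simp only [rPt]
    nlinarith [mul_pos hε hk]

/-- In a sub-moon, Bob obtains all red points. -/
lemma card_le_gameM_subMoon {n : ℕ} {ε : ℝ} (hn : 2 ≤ n) (hε0 : 0 < ε)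
    (hε : Real.cos (Real.pi / n) < 1 - ε) {a b : ℕ} {I : Finset ℕ} (hab : a < b) (hb : b ≤ n)
    (hI : ∀ j ∈ I, a < j ∧ j < b) :
    I.card ≤ gameM (moonW n ε) (subMoon n ε a b I) := by
  have hε' : 0 < 1 - ε := (cos_pi_div_nonneg hn).trans_lt hε
  induction hm : I.card generalizing a b I with
  | zero => exact Nat.zero_le _
  | succ m ih =>
    have hIne : I.Nonempty := Finset.card_pos.1 (by omega)
    have hle : ∀ k, (k = a ∨ k = b ∨ k ∈ I) → k ≤ n := by
      rintro k (rfl | rfl | hk)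
      · omega
      · exact hb
      · have := hI k hk; omega
    have ginj : ∀ {j k}, (j = a ∨ j = b ∨ j ∈ I) → (k = a ∨ k = b ∨ k ∈ I) →
        gPt n j = gPt n k → j = k := fun hj hk h => gPt_inj hn (hle _ hj) (hle _ hk) h
    have rinj : ∀ {j k}, j ∈ I → k ∈ I → rPt n ε j = rPt n ε k → j = k := fun hj hk h =>
      rPt_inj hn hε' (hle _ (.inr (.inr hj))) (hle _ (.inr (.inr hk))) h
    have hgr : ∀ {j k}, gPt n j ≠ rPt n ε k := gPt_ne_rPt hε' hε0
    have hga : gPt n a ∈ subMoon n ε a b I := mem_subMoon.2 (.inl ⟨a, by simp, rfl⟩)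
    have hgb : gPt n b ∈ subMoon n ε a b I := mem_subMoon.2 (.inl ⟨b, by simp, rfl⟩)
    have hw : ∀ j ∈ I, moonW n ε (rPt n ε j) = 1 := by
      intro j hj
      have := hI j hj
      exact if_pos (Finset.mem_image_of_mem _ (Finset.mem_Icc.2 (by omega)))
    refine le_gameM _ (Finset.one_lt_card.2 ⟨_, hga, _, hgb, fun h =>
      hab.ne (ginj (by simp) (by simp) h)⟩) ⟨gPt n a, ?_⟩ fun p hp => ?_
    · have := mem_exPts_of_radial (C := subMoon n ε a b I) (j := a) (s := 1) hn hε0 hε (by omega)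
        (by linarith) (by simpa using hga) fun p hp hpa => ?_
      · simpa using this
      · rw [one_smul] at hpa
        rcases mem_subMoon.1 hp with ⟨k, hk, rfl⟩ | ⟨k, hk, rfl⟩
        · exact .inr ⟨k, hle k hk, fun h => hpa (h ▸ rfl), .inl rfl⟩
        · exact .inr ⟨k, hle k (by simp [hk]), (hI k hk).1.ne', .inr rfl⟩
    -- The removal of `gPt n i` is answered by that of `rPt n ε j`, leaving a smaller sub-moon.
    have answer : ∀ i j a' b' : ℕ, j ∈ I → (i = a ∨ i = b ∨ i ∈ I) →
        a' < b' → b' ≤ n → (∀ k ∈ I.erase j, a' < k ∧ k < b') →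
        (∀ k, (k = a' ∨ k = b' ∨ k ∈ I.erase j) ↔ k ≠ i ∧ (k = a ∨ k = b ∨ k ∈ I)) →
        rPt n ε j ∈ exPts ((subMoon n ε a b I).erase (gPt n i)) →
        ∃ q ∈ exPts ((subMoon n ε a b I).erase (gPt n i)),
          m + 1 ≤ moonW n ε q +
            gameM (moonW n ε) (((subMoon n ε a b I).erase (gPt n i)).erase q) := by
      intro i j a' b' hj hi hab' hb' hI' hiff hex
      refine ⟨_, hex, ?_⟩
      have hS : ((subMoon n ε a b I).erase (gPt n i)).erase (rPt n ε j) =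
          subMoon n ε a' b' (I.erase j) := by
        ext p
        rw [Finset.mem_erase, Finset.mem_erase, mem_subMoon, mem_subMoon]
        simp only [hiff]
        constructor
        · rintro ⟨hpr, hpg, ⟨k, hk, rfl⟩ | ⟨k, hk, rfl⟩⟩
          · exact .inl ⟨k, ⟨fun h => hpg (h ▸ rfl), hk⟩, rfl⟩
          · exact .inr ⟨k, Finset.mem_erase.2 ⟨fun h => hpr (h ▸ rfl), hk⟩, rfl⟩
        · rintro (⟨k, ⟨hki, hk⟩, rfl⟩ | ⟨k, hk, rfl⟩)
          · exact ⟨hgr, fun h => hki (ginj hk hi h), .inl ⟨k, hk, rfl⟩⟩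
          · obtain ⟨hkj, hk⟩ := Finset.mem_erase.1 hk
            exact ⟨fun h => hkj (rinj hk hj h), hgr.symm, .inr ⟨k, hk, rfl⟩⟩
      have := ih hab' hb' hI' (by rw [Finset.card_erase_of_mem hj]; omega)
      rw [hS, hw j hj]
      omega
    obtain ⟨i, hi, rfl⟩ := exPts_subMoon hn hε0 hε hb hI hp
    have hrmem : ∀ j ∈ I, rPt n ε j ∈ (subMoon n ε a b I).erase (gPt n i) := fun j hj =>
      Finset.mem_erase.2 ⟨hgr.symm, mem_subMoon.2 (.inr ⟨j, hj, rfl⟩)⟩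
    rcases hi with rfl | rfl | hiI
    · obtain ⟨j, hj, hmin⟩ : ∃ j ∈ I, ∀ k ∈ I, j ≤ k :=
        ⟨_, I.min'_mem hIne, fun k hk => I.min'_le k hk⟩
      have hmin' : ∀ k ∈ I, k ≠ j → j < k := fun k hk hkj =>
        lt_of_le_of_ne (hmin k hk) hkj.symm
      refine answer i j j b hj (by simp) (hI j hj).2 hb (by grind) (by grind)
        (rPt_mem_exPts_of_side hε0 hε' 1 (hrmem j hj) fun p hp hpr => ?_)
      obtain ⟨hpi, hp⟩ := Finset.mem_erase.1 hp
      have := hI j hj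
      have hside : ∀ k, j < k → k ≤ n →
          0 < 1 * Real.sin (k * Real.pi / n - j * Real.pi / n) := fun k hk hkn => by
        rw [one_mul]
        exact sin_angle_sub_pos hn hk (by omega)
      rcases mem_subMoon.1 hp with ⟨k, hk, rfl⟩ | ⟨k, hk, rfl⟩
      · by_cases hkj : k = j
        · exact .inl (hkj ▸ rfl)
        · exact .inr ⟨k, hside k (by grind) (hle k hk), .inl rfl⟩
      · exact .inr ⟨k, hside k (by grind) (hle k (by simp [hk])), .inr rfl⟩
    · obtain ⟨j, hj, hmax⟩ : ∃ j ∈ I, ∀ k ∈ I, k ≤ j :=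
        ⟨_, I.max'_mem hIne, fun k hk => I.le_max' k hk⟩
      have hmax' : ∀ k ∈ I, k ≠ j → k < j := fun k hk hkj =>
        lt_of_le_of_ne (hmax k hk) hkj
      have := hI j hj
      refine answer i j a j hj (by simp) (hI j hj).1 (by omega) (by grind) (by grind)
        (rPt_mem_exPts_of_side hε0 hε' (-1) (hrmem j hj) fun p hp hpr => ?_)
      obtain ⟨hpi, hp⟩ := Finset.mem_erase.1 hp
      have hside : ∀ k, k < j →
          0 < -1 * Real.sin (k * Real.pi / n - j * Real.pi / n) := fun k hk => by
        rw [neg_one_mul, ← Real.sin_neg, neg_sub]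
        exact sin_angle_sub_pos hn hk (by omega)
      rcases mem_subMoon.1 hp with ⟨k, hk, rfl⟩ | ⟨k, hk, rfl⟩
      · by_cases hkj : k = j
        · exact .inl (hkj ▸ rfl)
        · exact .inr ⟨k, hside k (by grind), .inl rfl⟩
      · exact .inr ⟨k, hside k (by grind), .inr rfl⟩
    · have := hI i hiI
      refine answer i i a b hiI (by simp [hiI]) hab hb (by grind) (by grind) ?_
      have hmem := hrmem i hiI
      rw [rPt_eq_smul] at hmem ⊢
      refine mem_exPts_of_radial hn hε0 hε (by omega) le_rfl hmem fun p hp hpr => .inr ?_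
      rw [← rPt_eq_smul] at hpr
      obtain ⟨hpi, hp⟩ := Finset.mem_erase.1 hp
      rcases mem_subMoon.1 hp with ⟨k, hk, rfl⟩ | ⟨k, hk, rfl⟩
      · exact ⟨k, hle k hk, fun h => hpi (h ▸ rfl), .inl rfl⟩
      · exact ⟨k, hle k (by simp [hk]), fun h => hpr (h ▸ rfl), .inr rfl⟩

lemma moonPts_eq_subMoon {n : ℕ} (hn : 2 ≤ n) (ε : ℝ) :
    moonPts n ε = subMoon n ε 0 n (Finset.Icc 1 (n - 1)) := by
  have : Finset.range (n + 1) = insert 0 (insert n (Finset.Icc 1 (n - 1))) := by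
    ext k
    simp only [Finset.mem_range, Finset.mem_insert, Finset.mem_Icc]
    omega
  rw [moonPts, moonGreens, moonReds, subMoon, this]

/-- For every `n ≥ 2` and admissible `ε` such that the moon `𝓛ₙ` is in
general position, the minimax result on the moon is `M(𝓛ₙ) = n − 1 = R(𝓛ₙ)`:
Bob obtains all red points. -/
theorem statement7 (n : ℕ) (hn : 2 ≤ n) (ε : ℝ)
    (hε0 : 0 < ε) (hε1 : ε < 1 - Real.cos (Real.pi / (2 * n)))
    (hgp : GenPos (↑(moonPts n ε) : Set (ℝ × ℝ))) :
    gameM (moonW n ε) (moonPts n ε) = n - 1 ∧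
    ((moonPts n ε).filter (fun p => moonW n ε p = 1)).card = n - 1 := by
  have hε := cos_pi_div_lt_of_admissible hn hε1
  have hε' : 0 < 1 - ε := (cos_pi_div_nonneg hn).trans_lt hε
  have hcard : ((moonPts n ε).filter (fun p => moonW n ε p = 1)).card = n - 1 := by
    have hfilter : (moonPts n ε).filter (fun p => moonW n ε p = 1) = moonReds n ε := by
      ext p
      by_cases hp : p ∈ moonReds n ε <;> simp [moonW, moonPts, hp]
    rw [hfilter, moonReds, Finset.card_image_of_injOn, Nat.card_Icc, Nat.add_sub_cancel]
    intro j hj k hk h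
    simp only [Finset.coe_Icc, Set.mem_Icc] at hj hk
    exact rPt_inj hn hε' (by omega) (by omega) h
  refine ⟨le_antisymm ?_ ?_, hcard⟩
  · refine (gameM_le_sum _ _).trans (le_of_eq ?_)
    rw [← hcard, Finset.card_filter]
    refine Finset.sum_congr rfl fun p _ => ?_
    by_cases hp : p ∈ moonReds n ε <;> simp [moonW, hp]
  · rw [moonPts_eq_subMoon hn]
    have := card_le_gameM_subMoon hn hε0 hε (a := 0) (b := n) (I := Finset.Icc 1 (n - 1))
      (by omega) le_rfl fun j hj => by
        rw [Finset.mem_Icc] at hj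
        omega
    rwa [Nat.card_Icc, Nat.add_sub_cancel] at this

end
end

section
/- For every odd integer k > 2 there exists an even-sized cake 𝒞 with R(𝒞) = 2k + 1 such that M(𝒞) ≤ (1/4)·R(𝒞) + 1/4 = (k + 1)/2; that is, there are even-sized cakes with arbitrarily many red points on which Alice obtains at least about three quarters of the total weight. -/
open scoped Classical

noncomputable section

/-! ### One move of the game -/

lemma mem_exPts {C : Finset (ℝ × ℝ)} {c : ℝ × ℝ} :
    c ∈ exPts C ↔ c ∈ C ∧ c ∉ convexHull ℝ ((C.erase c : Finset (ℝ × ℝ)) : Set (ℝ × ℝ)) := by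
  simp [exPts]

lemma gameM_le_gameMB_erase {w : ℝ × ℝ → ℕ} {C : Finset (ℝ × ℝ)} {a : ℝ × ℝ} (ha : a ∈ exPts C) :
    gameM w C ≤ gameMB w (C.erase a) := by
  rw [gameM]
  split_ifs with h
  · exact Nat.zero_le _
  · refine (Nat.sInf_le (Finset.mem_coe.2
      (Finset.mem_image_of_mem _ (Finset.mem_attach _ ⟨a, ha⟩)))).trans ?_
    refine Finset.sup_le fun b _ => ?_
    exact Finset.le_sup (f := fun b => w b + gameM w ((C.erase a).erase b)) b.2

/-! ### Labelled configurations

The points are labelled by `none` (the centre) and by `some (i, n)`, the point of rank `n` in the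
group `i`. -/

section Labelled

variable {k : ℕ} (pt : Option (ZMod k × Fin 6) → ℝ × ℝ)

/-- The point labelled `v` is an extremal point of the configuration labelled by `S`. -/
def IsExt (S : Finset (Option (ZMod k × Fin 6))) (v : Option (ZMod k × Fin 6)) : Prop :=
  v ∈ S ∧ pt v ∉ convexHull ℝ (pt '' ↑(S.erase v))

variable {pt}

lemma IsExt.mono {S T : Finset (Option (ZMod k × Fin 6))} {v : Option (ZMod k × Fin 6)}
    (h : IsExt pt S v) (hT : T ⊆ S) (hv : v ∈ T) : IsExt pt T v :=
  ⟨hv, fun hc => h.2 (convexHull_mono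
    (Set.image_mono (Finset.coe_subset.2 (Finset.erase_subset_erase v hT))) hc)⟩

lemma mem_exPts_image (hpt : Function.Injective pt) {S : Finset (Option (ZMod k × Fin 6))}
    {v : Option (ZMod k × Fin 6)} : pt v ∈ exPts (S.image pt) ↔ IsExt pt S v := by
  rw [mem_exPts, ← Finset.image_erase hpt, Finset.coe_image, IsExt, hpt.mem_finset_image]

/-- The labels of the red points. -/
def IsRed : Option (ZMod k × Fin 6) → Prop
  | none => False
  | some (_, n) => n = 1 ∨ n = 3

/-- Bob gets at most `B` if Alice has a good answer to each of his moves. -/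
lemma gameMB_image_le (hpt : Function.Injective pt) {w : ℝ × ℝ → ℕ}
    {S : Finset (Option (ZMod k × Fin 6))} {B : ℕ}
    (h : ∀ v, IsExt pt S v → (S.erase v = ∅ ∧ w (pt v) ≤ B) ∨
      ∃ u, IsExt pt (S.erase v) u ∧
        w (pt v) + gameMB w (((S.erase v).erase u).image pt) ≤ B) :
    gameMB w (S.image pt) ≤ B := by
  refine Finset.sup_le fun b hb => ?_
  obtain ⟨v, hv, rfl⟩ := Finset.mem_image.1 (mem_exPts.1 hb).1
  rw [mem_exPts_image hpt] at hb
  rw [← Finset.image_erase hpt]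
  obtain ⟨h0, hB⟩ | ⟨u, hu, hB⟩ := h v hb
  · rw [h0, gameM]
    simpa using hB
  · refine le_trans ?_ hB
    have := gameM_le_gameMB_erase (w := w) ((mem_exPts_image hpt).2 hu)
    rw [← Finset.image_erase hpt] at this
    omega

/-- No surviving group lies to the left of group `i`. -/
def NoLeft (left : ZMod k → ZMod k → Prop) (S : Finset (Option (ZMod k × Fin 6)))
    (i : ZMod k) : Prop := ∀ j n, some (j, n) ∈ S → ¬ left i j

/-- No surviving group lies to the right of group `i`. -/
def NoRight (left : ZMod k → ZMod k → Prop) (S : Finset (Option (ZMod k × Fin 6)))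
    (i : ZMod k) : Prop := ∀ j n, some (j, n) ∈ S → ¬ left j i

/-- The facts about extremal points on which Alice's strategy relies. The relation `left i j` says
that group `j` lies to the left of the line from the centre through group `i`. -/
structure Arrangement [NeZero k] (pt : Option (ZMod k × Fin 6) → ℝ × ℝ)
    (left : ZMod k → ZMod k → Prop) : Prop where
  inj : Function.Injective pt
  left_or : ∀ i j, i ≠ j → left i j ∨ left j i
  count : ∀ i, 2 * (Finset.univ.filter fun j => left j i).card + 1 ≤ k
  ext_top : ∀ S i n, some (i, n) ∈ S → (∀ m < n, some (i, m) ∉ S) → IsExt pt S (some (i, n))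
  two_sided : ∀ S i r n, (r = 0 ∨ r = 2) → r < n → some (i, r) ∈ S →
    IsExt pt S (some (i, n)) → NoLeft left S i ∨ NoRight left S i
  ext_four : ∀ S i, some (i, 0) ∈ S → some (i, 5) ∈ S → IsExt pt S (some (i, 4)) → NoLeft left S i
  ext_five : ∀ S i, some (i, 0) ∈ S → some (i, 4) ∈ S → IsExt pt S (some (i, 5)) → NoRight left S i
  not_ext : ∀ S i n, some (i, 0) ∈ S → some (i, 4) ∈ S → some (i, 5) ∈ S →
    (n = 1 ∨ n = 2 ∨ n = 3) → ¬ IsExt pt S (some (i, n))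
  ext_left : ∀ S i n, NoLeft left S i → none ∉ S → some (i, 4) ∉ S → (n = 1 ∨ n = 3) →
    some (i, n) ∈ S → IsExt pt S (some (i, n))
  ext_left_four : ∀ S i, NoLeft left S i → none ∉ S → some (i, 4) ∈ S → IsExt pt S (some (i, 4))
  ext_right : ∀ S i, NoRight left S i → some (i, 5) ∉ S → some (i, 3) ∈ S →
    IsExt pt S (some (i, 3))
  ext_centre : ∀ S i n, some (i, n) ∈ S → (NoLeft left S i ∨ NoRight left S i) → none ∈ S →
    IsExt pt S none
  exists_noLeft : ∀ S, IsExt pt (insert none S) none → (∃ i n, some (i, n) ∈ S) →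
    ∃ i n, some (i, n) ∈ S ∧ NoLeft left S i

/-- The groups that still have a red point. -/
def redGroups [NeZero k] (S : Finset (Option (ZMod k × Fin 6))) : Finset (ZMod k) :=
  Finset.univ.filter fun i => some (i, 1) ∈ S ∨ some (i, 3) ∈ S

/-- The position is one-sided, and each group with two red points is complete, except that the
point of rank `4` may be missing in a group at the left end. -/
def OneSided (pt : Option (ZMod k × Fin 6) → ℝ × ℝ) (left : ZMod k → ZMod k → Prop)
    (S : Finset (Option (ZMod k × Fin 6))) : Prop :=
  IsExt pt (insert none S) none ∧ ∀ i, some (i, 1) ∈ S → some (i, 3) ∈ S →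
    some (i, 0) ∈ S ∧ some (i, 2) ∈ S ∧ some (i, 5) ∈ S ∧ (some (i, 4) ∈ S ∨ NoLeft left S i)

/-- In addition to `OneSided`, the point of rank `4` of a group with two red points is missing only
if the centre is gone. -/
def OneSidedBob (pt : Option (ZMod k × Fin 6) → ℝ × ℝ) (left : ZMod k → ZMod k → Prop)
    (S : Finset (Option (ZMod k × Fin 6))) : Prop :=
  OneSided pt left S ∧ ∀ i, some (i, 1) ∈ S → some (i, 3) ∈ S → some (i, 4) ∈ S ∨ none ∉ S

variable {left : ZMod k → ZMod k → Prop}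

lemma NoLeft.mono {S T : Finset (Option (ZMod k × Fin 6))} {i : ZMod k} (h : NoLeft left S i)
    (hT : T ⊆ S) : NoLeft left T i := fun j n hj => h j n (hT hj)

lemma redGroups_mono [NeZero k] {S T : Finset (Option (ZMod k × Fin 6))} (hT : T ⊆ S) :
    redGroups T ⊆ redGroups S := by
  intro i
  simp only [redGroups, Finset.mem_filter, Finset.mem_univ, true_and]
  exact Or.imp (@hT _) (@hT _)

/-- A subset of a one-sided position is one-sided if no group with two red points is touched. -/
lemma OneSided.of_subset {S T : Finset (Option (ZMod k × Fin 6))} (h : OneSided pt left S)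
    (hT : T ⊆ S) (hg : ∀ i n, some (i, 1) ∈ T → some (i, 3) ∈ T → some (i, n) ∈ S →
      some (i, n) ∈ T ∨ n = 4 ∧ NoLeft left T i) : OneSided pt left T := by
  refine ⟨h.1.mono (Finset.insert_subset_insert _ hT) (Finset.mem_insert_self _ _), ?_⟩
  intro i h1 h3
  obtain ⟨a0, a2, a5, a4⟩ := h.2 i (hT h1) (hT h3)
  refine ⟨?_, ?_, ?_, ?_⟩
  · simpa using hg i 0 h1 h3 a0
  · simpa using hg i 2 h1 h3 a2
  · simpa using hg i 5 h1 h3 a5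
  · obtain a4 | a4 := a4
    · simpa using hg i 4 h1 h3 a4
    · exact Or.inr (a4.mono hT)

variable [NeZero k]

/-- In a one-sided position Alice has a waiting move. -/
lemma Arrangement.exists_waiting_move (A : Arrangement pt left)
    {S : Finset (Option (ZMod k × Fin 6))} (h : OneSided pt left S) (hS : S ≠ ∅) :
    ∃ u, IsExt pt S u ∧ OneSidedBob pt left (S.erase u) := by
  by_cases hz : none ∈ S
  · refine ⟨none, h.1.mono (Finset.subset_insert _ _) hz,
      h.of_subset (Finset.erase_subset _ _) ?_, fun i _ _ => Or.inr (by simp)⟩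
    intro i n _ _ hn
    exact Or.inl (by simpa using hn)
  by_cases hf : ∃ i n, some (i, n) ∈ S ∧ ¬ (some (i, 1) ∈ S ∧ some (i, 3) ∈ S)
  · obtain ⟨i, n, hn, hi⟩ := hf
    have hne : (Finset.univ.filter fun m : Fin 6 => some (i, m) ∈ S).Nonempty :=
      ⟨n, by simpa using hn⟩
    have hm := Finset.min'_mem _ hne
    have hmin : ∀ m' < (Finset.univ.filter fun m : Fin 6 => some (i, m) ∈ S).min' hne,
        some (i, m') ∉ S := fun m' hlt hm' =>
      (Finset.min'_le _ m' (by simpa using hm')).not_gt hlt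
    generalize (Finset.univ.filter fun m : Fin 6 => some (i, m) ∈ S).min' hne = m at hm hmin
    have hm : some (i, m) ∈ S := by simpa using hm
    refine ⟨some (i, m), A.ext_top S i m hm hmin, h.of_subset (Finset.erase_subset _ _) ?_,
      fun _ _ _ => Or.inr (by simp [hz])⟩
    intro j l h1 h3 hl
    left
    refine Finset.mem_erase.2 ⟨?_, hl⟩
    rintro heq
    obtain ⟨rfl, rfl⟩ : j = i ∧ l = m := by simpa using heq
    exact hi ⟨Finset.mem_of_mem_erase h1, Finset.mem_of_mem_erase h3⟩
  · push Not at hf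
    have hex : ∃ i n, some (i, n) ∈ S := by
      obtain ⟨v, hv⟩ := Finset.nonempty_iff_ne_empty.2 hS
      rcases v with _ | ⟨i, n⟩
      · exact absurd hv hz
      · exact ⟨i, n, hv⟩
    obtain ⟨i, n, hn, hi⟩ := A.exists_noLeft S h.1 hex
    obtain ⟨h1, h3⟩ := hf i n hn
    by_cases h4 : some (i, 4) ∈ S
    · refine ⟨some (i, 4), A.ext_left_four S i hi hz h4, h.of_subset (Finset.erase_subset _ _) ?_,
        fun _ _ _ => Or.inr (by simp [hz])⟩
      intro j l _ _ hl
      by_cases heq : j = i ∧ l = 4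
      · obtain ⟨rfl, rfl⟩ := heq
        exact Or.inr ⟨rfl, hi.mono (Finset.erase_subset _ _)⟩
      · exact Or.inl (Finset.mem_erase.2 ⟨by simpa using heq, hl⟩)
    · refine ⟨some (i, 3), A.ext_left S i 3 hi hz h4 (Or.inr rfl) h3,
        h.of_subset (Finset.erase_subset _ _) ?_, fun _ _ _ => Or.inr (by simp [hz])⟩
      intro j l _ hj hl
      refine Or.inl (Finset.mem_erase.2 ⟨?_, hl⟩)
      intro heq
      obtain ⟨rfl, rfl⟩ : j = i ∧ l = 3 := by simpa using heq
      simp at hj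

/-- Alice can answer a move in a group with two red points by taking a red point of that group. -/
lemma Arrangement.exists_red_answer (A : Arrangement pt left)
    {S : Finset (Option (ZMod k × Fin 6))} (h : OneSidedBob pt left S) {i : ZMod k} {n : Fin 6}
    (h1 : some (i, 1) ∈ S) (h3 : some (i, 3) ∈ S) (hx : IsExt pt S (some (i, n)))
    (hn : n = 4 → ¬ NoLeft left S i) :
    ∃ m, (m = 1 ∨ m = 3) ∧ m ≠ n ∧ IsExt pt (S.erase (some (i, n))) (some (i, m)) := by
  obtain ⟨a0, a2, a5, a4⟩ := h.1.2 i h1 h3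
  have key : ∀ m, m ≠ n → some (i, m) ∈ S → some (i, m) ∈ S.erase (some (i, n)) :=
    fun m hm hmS => Finset.mem_erase.2 ⟨by simpa using hm, hmS⟩
  by_cases h4 : some (i, 4) ∈ S
  · fin_cases n
    · refine ⟨1, Or.inl rfl, by decide, A.ext_top _ i 1 (key 1 (by decide) h1) ?_⟩
      intro m hm
      obtain rfl : m = 0 := by omega
      simp
    · exact absurd hx (A.not_ext S i 1 a0 h4 a5 (by simp))
    · exact absurd hx (A.not_ext S i 2 a0 h4 a5 (by simp))
    · exact absurd hx (A.not_ext S i 3 a0 h4 a5 (by simp))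
    · exact absurd (A.ext_four S i a0 a5 hx) (hn rfl)
    · refine ⟨3, Or.inr rfl, by decide, A.ext_right _ i ?_ (by simp) (key 3 (by decide) h3)⟩
      exact fun j l hj => A.ext_five S i a0 h4 hx j l (Finset.mem_of_mem_erase hj)
  · have hl : NoLeft left S i := a4.resolve_left h4
    have hz : none ∉ S := (h.2 i h1 h3).resolve_left h4
    by_cases hn3 : n = 3
    · refine ⟨1, Or.inl rfl, by simp [hn3], ?_⟩
      exact (A.ext_left S i 1 hl hz h4 (Or.inl rfl) h1).mono (Finset.erase_subset _ _)
        (key 1 (by simp [hn3]) h1)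
    · refine ⟨3, Or.inr rfl, Ne.symm hn3, ?_⟩
      exact (A.ext_left S i 3 hl hz h4 (Or.inr rfl) h3).mono (Finset.erase_subset _ _)
        (key 3 (Ne.symm hn3) h3)

/-- In a one-sided position Bob gets at most one red point per group. -/
lemma Arrangement.gameMB_le_of_oneSided (A : Arrangement pt left) {w : ℝ × ℝ → ℕ}
    (hw : ∀ v, w (pt v) = if IsRed v then 1 else 0) :
    ∀ (N : ℕ) (S : Finset (Option (ZMod k × Fin 6))), S.card = N → OneSidedBob pt left S →
      gameMB w (S.image pt) ≤ (redGroups S).card := by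
  intro N
  induction N using Nat.strong_induction_on with
  | _ N ih =>
  intro S hN h
  refine gameMB_image_le A.inj fun x hx => ?_
  have hlt : (S.erase x).card < N := hN ▸ Finset.card_erase_lt_of_mem hx.1
  by_cases hcase : ∃ i n, x = some (i, n) ∧ some (i, 1) ∈ S ∧ some (i, 3) ∈ S ∧
      (n = 4 → ¬ NoLeft left S i)
  · obtain ⟨i, n, rfl, h1, h3, hn⟩ := hcase
    obtain ⟨m, hm, hmn, hy⟩ := A.exists_red_answer h h1 h3 hx hn
    refine Or.inr ⟨some (i, m), hy, ?_⟩
    have hsub : (S.erase (some (i, n))).erase (some (i, m)) ⊆ S :=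
      (Finset.erase_subset _ _).trans (Finset.erase_subset _ _)
    have hmem : ∀ j l, j ≠ i → some (j, l) ∈ S →
        some (j, l) ∈ (S.erase (some (i, n))).erase (some (i, m)) := by
      intro j l hj hl
      simp [hj, hl]
    have hnot : ∀ j, some (j, 1) ∈ (S.erase (some (i, n))).erase (some (i, m)) →
        some (j, 3) ∈ (S.erase (some (i, n))).erase (some (i, m)) → j ≠ i := by
      rintro j hj1 hj3 rfl
      rcases hm with rfl | rfl
      · simp at hj1
      · simp at hj3
    have hinv : OneSidedBob pt left ((S.erase (some (i, n))).erase (some (i, m))) := by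
      refine ⟨h.1.of_subset hsub ?_, ?_⟩
      · intro j l hj1 hj3 hl
        exact Or.inl (hmem j l (hnot j hj1 hj3) hl)
      · intro j hj1 hj3
        exact (h.2 j (hsub hj1) (hsub hj3)).imp (hmem j 4 (hnot j hj1 hj3))
          (fun hz hz' => hz (hsub hz'))
    have hIH := ih _ ((Finset.card_erase_lt_of_mem hy.1).trans hlt) _ rfl hinv
    have hle := Finset.card_le_card (redGroups_mono hsub)
    rw [hw]
    split_ifs with hr
    · have hss : redGroups ((S.erase (some (i, n))).erase (some (i, m))) ⊂ redGroups S := by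
        refine (Finset.ssubset_iff_of_subset (redGroups_mono hsub)).2
          ⟨i, by simp [redGroups, h1], ?_⟩
        simp only [IsRed] at hr
        rcases hm with rfl | rfl <;> rcases hr with rfl | rfl <;>
          simp [redGroups] at hmn ⊢
      have := Finset.card_lt_card hss
      omega
    · omega
  · have hsub : S.erase x ⊆ S := Finset.erase_subset _ _
    push Not at hcase
    have hone : OneSided pt left (S.erase x) := by
      refine h.1.of_subset hsub ?_
      intro j l h1 h3 hl
      by_cases hxl : x = some (j, l)
      · obtain ⟨h4, hnl⟩ := hcase j l hxl (hsub h1) (hsub h3)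
        exact Or.inr ⟨h4, hnl.mono hsub⟩
      · exact Or.inl (Finset.mem_erase.2 ⟨Ne.symm hxl, hl⟩)
    have hφ : w (pt x) + (redGroups (S.erase x)).card ≤ (redGroups S).card := by
      have hle := Finset.card_le_card (redGroups_mono hsub)
      rw [hw]
      split_ifs with hr
      · rcases x with _ | ⟨i, n⟩
        · exact hr.elim
        have hss : redGroups (S.erase (some (i, n))) ⊂ redGroups S := by
          refine (Finset.ssubset_iff_of_subset (redGroups_mono hsub)).2 ⟨i, ?_, ?_⟩
          · simp only [IsRed] at hr
            have := hx.1
            rcases hr with rfl | rfl <;> simp [redGroups, this]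
          · have hc := hcase i n rfl
            have hxS := hx.1
            simp only [IsRed] at hr
            simp only [redGroups, Finset.mem_filter, Finset.mem_univ, true_and, not_or]
            rcases hr with rfl | rfl
            · refine ⟨by simp, fun h3 => ?_⟩
              exact absurd (hc hxS (hsub h3)).1 (by decide)
            · refine ⟨fun h1 => ?_, by simp⟩
              exact absurd (hc (hsub h1) hxS).1 (by decide)
        have := Finset.card_lt_card hss
        omega
      · omega
    by_cases hemp : S.erase x = ∅
    · exact Or.inl ⟨hemp, by omega⟩
    · obtain ⟨u, hu, hinv⟩ := A.exists_waiting_move hone hemp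
      have hIH := ih _ ((Finset.card_erase_lt_of_mem hu.1).trans hlt) _ rfl hinv
      have hle := Finset.card_le_card (redGroups_mono (Finset.erase_subset u (S.erase x)))
      exact Or.inr ⟨u, hu, by omega⟩

/-- The centre is present and each group has lost an even number of its lowest ranks. -/
def IsStaircase (S : Finset (Option (ZMod k × Fin 6))) : Prop :=
  none ∈ S ∧ ∀ i, ∃ r : ℕ, Even r ∧ ∀ n : Fin 6, some (i, n) ∈ S ↔ r ≤ n

lemma Arrangement.card_redGroups_le (A : Arrangement pt left)
    {S : Finset (Option (ZMod k × Fin 6))} (h : IsExt pt (insert none S) none) :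
    2 * (redGroups S).card ≤ k + 1 := by
  by_cases hex : ∃ i n, some (i, n) ∈ S
  · obtain ⟨i, n, -, hi⟩ := A.exists_noLeft S h hex
    have hsub : redGroups S ⊆ insert i (Finset.univ.filter fun j => left j i) := by
      intro j hj
      simp only [redGroups, Finset.mem_filter, Finset.mem_univ, true_and] at hj
      simp only [Finset.mem_insert, Finset.mem_filter, Finset.mem_univ, true_and]
      by_cases hji : j = i
      · exact Or.inl hji
      · refine Or.inr ((A.left_or j i hji).resolve_right ?_)
        rcases hj with hj | hj
        · exact hi j _ hj
        · exact hi j _ hj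
    have h1 := (Finset.card_le_card hsub).trans (Finset.card_insert_le _ _)
    have h2 := A.count i
    omega
  · push Not at hex
    have : redGroups S = ∅ := by
      ext j
      simp [redGroups, hex]
    simp [this]

/-- From a staircase position Bob gets at most half of `k + 1`. -/
lemma Arrangement.gameMB_le_of_isStaircase (A : Arrangement pt left) {w : ℝ × ℝ → ℕ}
    (hw : ∀ v, w (pt v) = if IsRed v then 1 else 0) :
    ∀ (N : ℕ) (S : Finset (Option (ZMod k × Fin 6))), S.card = N → IsStaircase S →
      gameMB w (S.image pt) ≤ (k + 1) / 2 := by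
  intro N
  induction N using Nat.strong_induction_on with
  | _ N ih =>
  intro S hN h
  by_cases hz : IsExt pt S none
  · have hins : insert none S = S := Finset.insert_eq_of_mem h.1
    have hfull : ∀ i, some (i, 1) ∈ S → ∀ n, some (i, n) ∈ S := by
      intro i h1 n
      obtain ⟨r, hr, hS⟩ := h.2 i
      have := (hS 1).1 h1
      have h0 : r = 0 := by
        rcases hr with ⟨t, rfl⟩
        simp at this
        omega
      exact (hS n).2 (by omega)
    have hinv : OneSidedBob pt left S := by
      refine ⟨⟨by rwa [hins], fun i h1 _ => ?_⟩, fun i h1 _ => Or.inl (hfull i h1 4)⟩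
      exact ⟨hfull i h1 0, hfull i h1 2, hfull i h1 5, Or.inl (hfull i h1 4)⟩
    have h1 := A.gameMB_le_of_oneSided hw N S hN hinv
    have h2 := A.card_redGroups_le hinv.1.1
    omega
  · refine gameMB_image_le A.inj fun x hx => Or.inr ?_
    rcases x with _ | ⟨i, n⟩
    · exact absurd hx hz
    have htwo : ¬ (NoLeft left S i ∨ NoRight left S i) := fun hs =>
      hz (A.ext_centre S i n hx.1 hs h.1)
    obtain ⟨r, hr, hS⟩ := h.2 i
    have hrn := (hS n).1 hx.1
    have hn6 := n.isLt
    have hcases : ∃ m : Fin 6, m ≠ n ∧ ((n : ℕ) = r ∨ (n : ℕ) = r + 1) ∧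
        ((m : ℕ) = r ∨ (m : ℕ) = r + 1) ∧ (n = 0 ∨ n = 2 ∨ n = 4 ∨ n = 5) := by
      have hnot : ∀ q : Fin 6, (q = 0 ∨ q = 2) → (q : ℕ) = r → n = q := by
        intro q hq hqr
        by_contra hne
        have hlt : q < n := by
          rw [Fin.lt_def]
          have : (n : ℕ) ≠ q := fun h => hne (Fin.ext h)
          omega
        exact htwo (A.two_sided S i q n hq hlt ((hS q).2 hqr.ge) hx)
      have hr6 : r = 0 ∨ r = 2 ∨ r = 4 := by
        rcases hr with ⟨t, rfl⟩
        omega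
      rcases hr6 with rfl | rfl | rfl
      · obtain rfl := hnot 0 (by simp) rfl
        exact ⟨1, by decide, by simp, by simp, by simp⟩
      · obtain rfl := hnot 2 (by simp) rfl
        exact ⟨3, by decide, by simp, by simp, by simp⟩
      · have : n = 4 ∨ n = 5 := by
          fin_cases n <;> simp at hrn ⊢
        rcases this with rfl | rfl
        · exact ⟨5, by decide, by simp, by simp, by simp⟩
        · exact ⟨4, by decide, by simp, by simp, by simp⟩
    obtain ⟨m, hmn, hn, hm, hgreen⟩ := hcases
    have hmn' : (m : ℕ) ≠ n := fun h => hmn (Fin.ext h)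
    have hy : IsExt pt (S.erase (some (i, n))) (some (i, m)) := by
      refine A.ext_top _ i m (Finset.mem_erase.2 ⟨by simpa using hmn, (hS m).2 (by omega)⟩) ?_
      intro l hl hlS
      have h1 := Finset.mem_erase.1 hlS
      have h2 := (hS l).1 h1.2
      have h3 : (l : ℕ) ≠ n := fun h => h1.1 (by rw [Fin.ext h])
      rw [Fin.lt_def] at hl
      omega
    refine ⟨some (i, m), hy, ?_⟩
    have hinv : IsStaircase ((S.erase (some (i, n))).erase (some (i, m))) := by
      refine ⟨by simp [h.1], fun j => ?_⟩
      by_cases hj : j = i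
      · subst hj
        refine ⟨r + 2, hr.add (by decide), fun l => ?_⟩
        simp only [Finset.mem_erase, hS l, ne_eq, Option.some.injEq, Prod.mk.injEq, true_and,
          Fin.ext_iff]
        omega
      · obtain ⟨r', hr', hS'⟩ := h.2 j
        exact ⟨r', hr', fun l => by simp [hj, hS' l]⟩
    have hIH := ih _ ((Finset.card_erase_lt_of_mem hy.1).trans
      (hN ▸ Finset.card_erase_lt_of_mem hx.1)) _ rfl hinv
    have hw0 : w (pt (some (i, n))) = 0 := by
      rw [hw, if_neg]
      rcases hgreen with rfl | rfl | rfl | rfl <;> simp [IsRed]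
    omega

end Labelled


/-! ### The directions of the groups -/

/-- Rotation of `v` by the direction `u`, that is, complex multiplication. -/
def rotate (u v : ℝ × ℝ) : ℝ × ℝ := (u.1 * v.1 - u.2 * v.2, u.2 * v.1 + u.1 * v.2)

lemma orientDet_rotate (u p q r : ℝ × ℝ) : orientDet (rotate u p) (rotate u q) (rotate u r) =
    (u.1 ^ 2 + u.2 ^ 2) * orientDet p q r := by
  simp only [orientDet, rotate]
  ring

section Direction

variable {k : ℕ} [NeZero k]

/-- The direction of the group `a`, as a point of the unit circle. -/
def dir (a : ZMod k) : ℝ × ℝ := ((ZMod.toCircle a : ℂ).re, (ZMod.toCircle a : ℂ).im)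

lemma dir_sq_add_sq (a : ZMod k) : (dir a).1 ^ 2 + (dir a).2 ^ 2 = 1 := by
  have := Circle.normSq_coe (ZMod.toCircle a)
  rw [Complex.normSq_apply] at this
  simp only [dir]
  linarith

lemma dir_zero : dir (0 : ZMod k) = (1, 0) := by simp [dir]

lemma dir_add (a b : ZMod k) : dir (a + b) = rotate (dir a) (dir b) := by
  simp only [dir, rotate, AddChar.map_add_eq_mul, Circle.coe_mul, Complex.mul_re, Complex.mul_im]
  ext <;> ring

lemma dir_injective : Function.Injective (dir : ZMod k → ℝ × ℝ) := by
  intro a b h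
  simp only [dir, Prod.mk.injEq] at h
  exact ZMod.injective_toCircle (Circle.ext (Complex.ext h.1 h.2))

lemma dir_neg (a : ZMod k) : dir (-a) = ((dir a).1, -(dir a).2) := by
  simp [dir, AddChar.map_neg_eq_inv]

lemma dir_fst_lt_one {a : ZMod k} (ha : a ≠ 0) : (dir a).1 < 1 := by
  have h := dir_sq_add_sq a
  by_contra! hc
  have h1 : (dir a).2 = 0 := by nlinarith [sq_nonneg (dir a).2]
  have h2 : (dir a).1 = 1 := by nlinarith
  exact ha (dir_injective (dir_zero (k := k) ▸ Prod.ext h2 h1))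

lemma dir_snd_ne_zero (hk : Odd k) {a : ZMod k} (ha : a ≠ 0) : (dir a).2 ≠ 0 := by
  intro h
  have h1 := dir_sq_add_sq a
  have h2 : dir (a + a) = dir (0 : ZMod k) := by
    rw [dir_add, dir_zero, rotate, h]
    ext
    · simp only
      nlinarith
    · simp
  have h3 := dir_injective h2
  have h4 : IsUnit ((2 : ℕ) : ZMod k) :=
    (ZMod.isUnit_iff_coprime 2 k).2 (Nat.coprime_two_left.2 hk)
  refine ha (h4.mul_left_cancel ?_)
  push_cast
  rw [two_mul, h3, mul_zero]

end Direction

/-! ### The points of a group -/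

/-- The depth of the point of rank `n`. -/
def depth (n : Fin 6) : ℝ := ![0, 1, 2, 3, 4, 4] n

/-- The lateral offset of the point of rank `n`. -/
def offset (n : Fin 6) : ℝ := ![0, -1, -3, -6, 1, -15] n

/-- The point of rank `n` in the group whose direction is `(1, 0)`. -/
def localPoint (ε : ℝ) (n : Fin 6) : ℝ × ℝ := (1 - ε * depth n, ε ^ 2 * offset n)

section Generic

variable {k : ℕ} [NeZero k]

/-- The point of rank `n` in the group `a`. -/
def groupPoint (ε : ℝ) (a : ZMod k) (n : Fin 6) : ℝ × ℝ := rotate (dir a) (localPoint ε n)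

variable (k) in
/-- The groups are so small that the position of points in different groups is governed by the
directions of the groups. -/
structure Generic (ε : ℝ) : Prop where
  pos : 0 < ε
  small : ε < 1 / 1000
  side : ∀ (a : ZMod k) (m n l : Fin 6), a ≠ 0 → depth m < depth n →
    0 < -(dir a).2 * orientDet (localPoint ε m) (localPoint ε n) (groupPoint ε a l)
  base : ∀ (a : ZMod k) (l : Fin 6), a ≠ 0 →
    0 < orientDet (localPoint ε 5) (localPoint ε 4) (groupPoint ε a l)
  cross : ∀ (a b : ZMod k) (n l m : Fin 6), 0 < (dir a).2 → (dir b).2 < 0 →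
    0 < orientDet (groupPoint ε a l) (groupPoint ε b m) (localPoint ε n)
  distinct : ∀ (a b : ZMod k) (n l m : Fin 6), a ≠ 0 → b ≠ 0 → a ≠ b →
    orientDet (groupPoint ε a l) (groupPoint ε b m) (localPoint ε n) ≠ 0
  front : ∀ (a : ZMod k) (l : Fin 6), a ≠ 0 →
    (groupPoint ε a l).1 + ε * (groupPoint ε a l).2 < 1 - 4 * ε - 15 * ε ^ 3
  tilt_right : ∀ (a : ZMod k) (l : Fin 6), (dir a).2 < 0 →
    0 < ε * (groupPoint ε a l).1 - (groupPoint ε a l).2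
  tilt_left : ∀ (a : ZMod k) (l : Fin 6), 0 < (dir a).2 →
    0 < ε * (groupPoint ε a l).1 + (groupPoint ε a l).2
  below : ∀ (a : ZMod k) (l : Fin 6), (dir a).2 < 0 →
    (groupPoint ε a l).2 + 4 * ε * (1 - (groupPoint ε a l).1) < 0
  above : ∀ (a : ZMod k) (l : Fin 6), 0 < (dir a).2 → 0 < (groupPoint ε a l).2
  fst_lt_one : ∀ (a : ZMod k) (l : Fin 6), a ≠ 0 → (groupPoint ε a l).1 < 1
  centre : ∀ (a : ZMod k) (n l : Fin 6), a ≠ 0 →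
    0 < (dir a).2 * orientDet 0 (localPoint ε n) (groupPoint ε a l)

lemma eventually_pos_of_eq_pow_mul {f g : ℝ → ℝ} (n : ℕ) (hf : Continuous f) (h0 : 0 < f 0)
    (h : ∀ ε, g ε = ε ^ n * f ε) : ∀ᶠ ε in nhdsWithin 0 (Set.Ioi 0), 0 < g ε := by
  have h1 : ∀ᶠ ε in nhdsWithin 0 (Set.Ioi 0), 0 < f ε :=
    ((hf.tendsto 0).eventually (lt_mem_nhds h0)).filter_mono nhdsWithin_le_nhds
  filter_upwards [h1, self_mem_nhdsWithin] with ε h2 h3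
  rw [h]
  exact mul_pos (pow_pos h3 n) h2

lemma eventually_pos_of_continuous {f : ℝ → ℝ} (hf : Continuous f) (h0 : 0 < f 0) :
    ∀ᶠ ε in nhdsWithin 0 (Set.Ioi 0), 0 < f ε :=
  eventually_pos_of_eq_pow_mul 0 hf h0 (by simp)

@[fun_prop]
lemma continuous_groupPoint (a : ZMod k) (n : Fin 6) : Continuous fun ε => groupPoint ε a n := by
  unfold groupPoint rotate localPoint
  fun_prop

@[fun_prop]
lemma continuous_localPoint (n : Fin 6) : Continuous fun ε => localPoint ε n := by
  unfold localPoint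
  fun_prop

lemma groupPoint_at_zero (a : ZMod k) (n : Fin 6) : groupPoint 0 a n = dir a := by
  simp [groupPoint, rotate, localPoint]

lemma localPoint_at_zero (n : Fin 6) : localPoint 0 n = (1, 0) := by simp [localPoint]

lemma det_dir_ne_zero {a b : ZMod k} (ha : a ≠ 0) (hb : b ≠ 0) (hab : a ≠ b) :
    orientDet (dir a) (dir b) (1, 0) ≠ 0 := by
  intro h
  have h1 := dir_sq_add_sq a
  have h2 := dir_sq_add_sq b
  have h3 := dir_fst_lt_one ha
  have h4 := dir_fst_lt_one hb
  refine hab (dir_injective ?_)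
  rcases hA : dir a with ⟨c, s⟩
  rcases hB : dir b with ⟨d, t⟩
  simp only [hA, hB, orientDet] at h h1 h2 h3 h4
  have h5 : s * (1 - d) = t * (1 - c) := by linarith
  have h6 : (1 - c) * (1 - d) * (c - d) = 0 := by
    have : (s * (1 - d)) ^ 2 = (t * (1 - c)) ^ 2 := by rw [h5]
    rw [mul_pow, mul_pow, show s ^ 2 = 1 - c ^ 2 by linarith, show t ^ 2 = 1 - d ^ 2 by linarith]
      at this
    linarith
  have h7 : c - d = 0 := by
    have : (1 - c) * (1 - d) ≠ 0 := mul_ne_zero (by linarith) (by linarith)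
    exact (mul_eq_zero.1 h6).resolve_left this
  have h8 : c = d := by linarith
  subst h8
  have h9 : s = t := mul_right_cancel₀ (by linarith) h5
  rw [h9]

lemma exists_generic (hk : Odd k) : ∃ ε, Generic k ε := by
  have h : ∀ᶠ ε in nhdsWithin (0 : ℝ) (Set.Ioi 0), Generic k ε := by
    have small : ∀ᶠ ε in nhdsWithin (0 : ℝ) (Set.Ioi 0), ε < 1 / 1000 :=
      (gt_mem_nhds (by norm_num : (0 : ℝ) < 1 / 1000)).filter_mono nhdsWithin_le_nhds
    have side : ∀ᶠ ε in nhdsWithin (0 : ℝ) (Set.Ioi 0), ∀ (a : ZMod k) (m n l : Fin 6), a ≠ 0 →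
        depth m < depth n →
        0 < -(dir a).2 * orientDet (localPoint ε m) (localPoint ε n) (groupPoint ε a l) := by
      simp only [Filter.eventually_all]
      intro a m n l ha hmn
      refine eventually_pos_of_eq_pow_mul (f := fun ε => (dir a).2 * ((depth n - depth m) *
        ((groupPoint ε a l).2 - ε ^ 2 * offset m) + ε * (offset n - offset m) *
        ((groupPoint ε a l).1 - 1 + ε * depth m))) 1 (by fun_prop) ?_ ?_
      · have := dir_snd_ne_zero hk ha
        have := mul_pos (sub_pos.2 hmn) (pow_pos (abs_pos.2 this) 2)
        rw [sq_abs] at this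
        simp only [groupPoint_at_zero]
        nlinarith
      · intro ε
        simp only [orientDet, localPoint]
        ring
    have base : ∀ᶠ ε in nhdsWithin (0 : ℝ) (Set.Ioi 0), ∀ (a : ZMod k) (l : Fin 6), a ≠ 0 →
        0 < orientDet (localPoint ε 5) (localPoint ε 4) (groupPoint ε a l) := by
      simp only [Filter.eventually_all]
      intro a l ha
      refine eventually_pos_of_eq_pow_mul (f := fun ε =>
        16 * (1 - 4 * ε - (groupPoint ε a l).1)) 2 (by fun_prop) ?_ ?_
      · have := dir_fst_lt_one ha
        simp only [groupPoint_at_zero]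
        linarith
      · intro ε
        simp [orientDet, localPoint, depth, offset]
        ring
    have cross : ∀ᶠ ε in nhdsWithin (0 : ℝ) (Set.Ioi 0), ∀ (a b : ZMod k) (n l m : Fin 6),
        0 < (dir a).2 → (dir b).2 < 0 →
        0 < orientDet (groupPoint ε a l) (groupPoint ε b m) (localPoint ε n) := by
      simp only [Filter.eventually_all]
      intro a b n l m ha hb
      refine eventually_pos_of_continuous (by unfold orientDet; fun_prop) ?_
      have ha' : a ≠ 0 := by rintro rfl; simp [dir_zero] at ha
      have hb' : b ≠ 0 := by rintro rfl; simp [dir_zero] at hb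
      have h1 := mul_pos ha (sub_pos.2 (dir_fst_lt_one hb'))
      have h2 := mul_pos (neg_pos.2 hb) (sub_pos.2 (dir_fst_lt_one ha'))
      simp only [groupPoint_at_zero, localPoint_at_zero, orientDet]
      linarith
    have distinct : ∀ᶠ ε in nhdsWithin (0 : ℝ) (Set.Ioi 0), ∀ (a b : ZMod k) (n l m : Fin 6),
        a ≠ 0 → b ≠ 0 → a ≠ b →
        orientDet (groupPoint ε a l) (groupPoint ε b m) (localPoint ε n) ≠ 0 := by
      simp only [Filter.eventually_all]
      intro a b n l m ha hb hab
      have hc : Continuous fun ε =>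
          orientDet (groupPoint ε a l) (groupPoint ε b m) (localPoint ε n) := by
        unfold orientDet; fun_prop
      refine (((hc.tendsto 0).eventually_ne ?_)).filter_mono nhdsWithin_le_nhds
      simpa only [groupPoint_at_zero, localPoint_at_zero] using det_dir_ne_zero ha hb hab
    have front : ∀ᶠ ε in nhdsWithin (0 : ℝ) (Set.Ioi 0), ∀ (a : ZMod k) (l : Fin 6), a ≠ 0 →
        0 < 1 - 4 * ε - 15 * ε ^ 3 - ((groupPoint ε a l).1 + ε * (groupPoint ε a l).2) := by
      simp only [Filter.eventually_all]
      intro a l ha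
      refine eventually_pos_of_continuous (by fun_prop) ?_
      have := dir_fst_lt_one ha
      simp only [groupPoint_at_zero]
      linarith
    have tilt_right : ∀ᶠ ε in nhdsWithin (0 : ℝ) (Set.Ioi 0), ∀ (a : ZMod k) (l : Fin 6),
        (dir a).2 < 0 → 0 < ε * (groupPoint ε a l).1 - (groupPoint ε a l).2 := by
      simp only [Filter.eventually_all]
      intro a l ha
      refine eventually_pos_of_continuous (by fun_prop) ?_
      simp only [groupPoint_at_zero]
      linarith
    have tilt_left : ∀ᶠ ε in nhdsWithin (0 : ℝ) (Set.Ioi 0), ∀ (a : ZMod k) (l : Fin 6),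
        0 < (dir a).2 → 0 < ε * (groupPoint ε a l).1 + (groupPoint ε a l).2 := by
      simp only [Filter.eventually_all]
      intro a l ha
      refine eventually_pos_of_continuous (by fun_prop) ?_
      simp only [groupPoint_at_zero]
      linarith
    have below : ∀ᶠ ε in nhdsWithin (0 : ℝ) (Set.Ioi 0), ∀ (a : ZMod k) (l : Fin 6),
        (dir a).2 < 0 →
        0 < -((groupPoint ε a l).2 + 4 * ε * (1 - (groupPoint ε a l).1)) := by
      simp only [Filter.eventually_all]
      intro a l ha
      refine eventually_pos_of_continuous (by fun_prop) ?_
      simp only [groupPoint_at_zero]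
      linarith
    have above : ∀ᶠ ε in nhdsWithin (0 : ℝ) (Set.Ioi 0), ∀ (a : ZMod k) (l : Fin 6),
        0 < (dir a).2 → 0 < (groupPoint ε a l).2 := by
      simp only [Filter.eventually_all]
      intro a l ha
      refine eventually_pos_of_continuous (by fun_prop) ?_
      simpa only [groupPoint_at_zero] using ha
    have fst_lt_one : ∀ᶠ ε in nhdsWithin (0 : ℝ) (Set.Ioi 0), ∀ (a : ZMod k) (l : Fin 6),
        a ≠ 0 → 0 < 1 - (groupPoint ε a l).1 := by
      simp only [Filter.eventually_all]
      intro a l ha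
      refine eventually_pos_of_continuous (by fun_prop) ?_
      have := dir_fst_lt_one ha
      simp only [groupPoint_at_zero]
      linarith
    have centre : ∀ᶠ ε in nhdsWithin (0 : ℝ) (Set.Ioi 0), ∀ (a : ZMod k) (n l : Fin 6),
        a ≠ 0 → 0 < (dir a).2 * orientDet 0 (localPoint ε n) (groupPoint ε a l) := by
      simp only [Filter.eventually_all]
      intro a n l ha
      refine eventually_pos_of_continuous (by unfold orientDet; fun_prop) ?_
      have := dir_snd_ne_zero hk ha
      have := pow_pos (abs_pos.2 this) 2
      rw [sq_abs] at this
      simp only [groupPoint_at_zero, localPoint_at_zero, orientDet, Prod.fst_zero, Prod.snd_zero]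
      linarith
    filter_upwards [self_mem_nhdsWithin, small, side, base, cross, distinct, front, tilt_right,
      tilt_left, below, above, fst_lt_one, centre] with ε h0 h1 h2 h3 h4 h5 h6 h7 h8 h9 h10 h11 h12
    exact ⟨h0, h1, h2, h3, h4, h5, fun a l ha => sub_pos.1 (h6 a l ha), h7, h8,
      fun a l ha => neg_pos.1 (h9 a l ha), h10, fun a l ha => sub_pos.1 (h11 a l ha), h12⟩
  exact h.exists

end Generic

/-! ### Criteria for extremal points -/

lemma mem_convexHull_of_orientDet_pos {s : Set (ℝ × ℝ)} {a b c p : ℝ × ℝ} (ha : a ∈ s)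
    (hb : b ∈ s) (hc : c ∈ s) (h1 : 0 < orientDet a b p) (h2 : 0 < orientDet b c p)
    (h3 : 0 < orientDet c a p) : p ∈ convexHull ℝ s := by
  set D := orientDet b c p + orientDet c a p + orientDet a b p with hD
  have hD0 : 0 < D := by positivity
  have h := (convex_convexHull ℝ s).sum_mem (t := (Finset.univ : Finset (Fin 3)))
    (w := ![orientDet b c p / D, orientDet c a p / D, orientDet a b p / D]) (z := ![a, b, c])
    (by intro i _; fin_cases i <;> simp <;> positivity)
    (by simp only [Fin.sum_univ_three]; simp; field_simp; rw [hD])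
    (by intro i _; fin_cases i <;> simp <;> apply subset_convexHull <;> assumption)
  convert h using 1
  simp only [Fin.sum_univ_three]
  ext
  · simp
    field_simp
    simp only [hD, orientDet]
    ring
  · simp
    field_simp
    simp only [hD, orientDet]
    ring

section Frame

variable {k : ℕ} [NeZero k]

/-- The configuration, rotated such that the group `i` gets the direction `(1, 0)`. -/
def framePoint (ε : ℝ) (i : ZMod k) : Option (ZMod k × Fin 6) → ℝ × ℝ
  | none => 0
  | some (j, n) => groupPoint ε (j - i) n

lemma groupPoint_zero (ε : ℝ) (n : Fin 6) : groupPoint ε (0 : ZMod k) n = localPoint ε n := by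
  simp [groupPoint, dir_zero, rotate]

@[simp] lemma framePoint_none (ε : ℝ) (i : ZMod k) : framePoint ε i none = 0 := rfl

lemma framePoint_some (ε : ℝ) (i j : ZMod k) (n : Fin 6) :
    framePoint ε i (some (j, n)) = groupPoint ε (j - i) n := rfl

@[simp] lemma framePoint_self (ε : ℝ) (i : ZMod k) (n : Fin 6) :
    framePoint ε i (some (i, n)) = localPoint ε n := by
  rw [framePoint_some, sub_self, groupPoint_zero]

lemma rotate_framePoint (ε : ℝ) (i : ZMod k) (v : Option (ZMod k × Fin 6)) :
    rotate (dir i) (framePoint ε i v) = framePoint ε 0 v := by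
  rcases v with _ | ⟨j, n⟩
  · simp [rotate]
  · have h := dir_add i (j - i)
    rw [add_sub_cancel] at h
    rw [framePoint_some, framePoint_some, sub_zero, groupPoint, groupPoint, h]
    simp only [rotate]
    ext <;> ring

lemma framePoint_fst (ε : ℝ) (i : ZMod k) (v : Option (ZMod k × Fin 6)) :
    (framePoint ε i v).1 =
      (dir i).1 * (framePoint ε 0 v).1 + (dir i).2 * (framePoint ε 0 v).2 := by
  rw [← rotate_framePoint ε i v]
  have := dir_sq_add_sq i
  simp only [rotate]
  linear_combination -(framePoint ε i v).1 * this

lemma framePoint_snd (ε : ℝ) (i : ZMod k) (v : Option (ZMod k × Fin 6)) :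
    (framePoint ε i v).2 =
      (dir i).1 * (framePoint ε 0 v).2 - (dir i).2 * (framePoint ε 0 v).1 := by
  rw [← rotate_framePoint ε i v]
  have := dir_sq_add_sq i
  simp only [rotate]
  linear_combination -(framePoint ε i v).2 * this

lemma orientDet_framePoint (ε : ℝ) (i : ZMod k) (u v v' : Option (ZMod k × Fin 6)) :
    orientDet (framePoint ε 0 u) (framePoint ε 0 v) (framePoint ε 0 v') =
      orientDet (framePoint ε i u) (framePoint ε i v) (framePoint ε i v') := by
  rw [← rotate_framePoint ε i u, ← rotate_framePoint ε i v, ← rotate_framePoint ε i v',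
    orientDet_rotate, dir_sq_add_sq, one_mul]

/-- A point at which a linear functional has a strict maximum is extremal. -/
lemma isExt_of_forall_lt {ε : ℝ} (i : ZMod k) (α β : ℝ) {S : Finset (Option (ZMod k × Fin 6))}
    {v : Option (ZMod k × Fin 6)} (hv : v ∈ S)
    (h : ∀ u ∈ S, u ≠ v → α * (framePoint ε i u).1 + β * (framePoint ε i u).2 <
      α * (framePoint ε i v).1 + β * (framePoint ε i v).2) :
    IsExt (framePoint ε 0) S v := by
  refine ⟨hv, fun hc => ?_⟩
  let L : ℝ × ℝ → ℝ := fun p =>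
    α * ((dir i).1 * p.1 + (dir i).2 * p.2) + β * ((dir i).1 * p.2 - (dir i).2 * p.1)
  have hL : IsLinearMap ℝ L := ⟨fun p q => by simp [L]; ring, fun t p => by simp [L]; ring⟩
  have hLf : ∀ u, L (framePoint ε 0 u) =
      α * (framePoint ε i u).1 + β * (framePoint ε i u).2 := fun u => by
    rw [framePoint_fst ε i u, framePoint_snd ε i u]
  have hsub : framePoint ε (0 : ZMod k) '' ↑(S.erase v) ⊆
      {q | L q < L (framePoint ε 0 v)} := by
    rintro _ ⟨u, hu, rfl⟩
    have hu' := Finset.mem_erase.1 (Finset.mem_coe.1 hu)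
    simpa only [Set.mem_ofPred_eq, hLf] using h u hu'.2 hu'.1
  exact lt_irrefl _ (Set.mem_ofPred_eq ▸ convexHull_min hsub (convex_halfSpace_lt hL _) hc)

/-- A point inside a triangle is not extremal. -/
lemma IsExt.not_mem_triangle {ε : ℝ} {S : Finset (Option (ZMod k × Fin 6))}
    {v : Option (ZMod k × Fin 6)} (h : IsExt (framePoint ε 0) S v) (i : ZMod k)
    {a b c : Option (ZMod k × Fin 6)} (ha : a ∈ S) (hb : b ∈ S) (hc : c ∈ S)
    (hav : a ≠ v) (hbv : b ≠ v) (hcv : c ≠ v)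
    (h1 : 0 < orientDet (framePoint ε i a) (framePoint ε i b) (framePoint ε i v))
    (h2 : 0 < orientDet (framePoint ε i b) (framePoint ε i c) (framePoint ε i v)) :
    ¬ 0 < orientDet (framePoint ε i c) (framePoint ε i a) (framePoint ε i v) := by
  intro h3
  rw [← orientDet_framePoint] at h1 h2 h3
  exact h.2 (mem_convexHull_of_orientDet_pos
    (Set.mem_image_of_mem _ (Finset.mem_coe.2 (Finset.mem_erase.2 ⟨hav, ha⟩)))
    (Set.mem_image_of_mem _ (Finset.mem_coe.2 (Finset.mem_erase.2 ⟨hbv, hb⟩)))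
    (Set.mem_image_of_mem _ (Finset.mem_coe.2 (Finset.mem_erase.2 ⟨hcv, hc⟩))) h1 h2 h3)

/-- Group `j` lies to the left of the line from the centre through group `i`. -/
def IsLeft (i j : ZMod k) : Prop := 0 < (dir (j - i)).2

lemma isLeft_swap {i j : ZMod k} : IsLeft j i ↔ (dir (j - i)).2 < 0 := by
  rw [IsLeft, ← neg_sub, dir_neg]
  simp

lemma isLeft_or (hk : Odd k) {i j : ZMod k} (h : i ≠ j) : IsLeft i j ∨ IsLeft j i := by
  have := dir_snd_ne_zero hk (sub_ne_zero.2 h.symm)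
  rw [isLeft_swap (i := i) (j := j)]
  exact this.lt_or_gt.symm

lemma IsLeft.ne {i j : ZMod k} (h : IsLeft i j) : j - i ≠ 0 := by
  intro h0
  simp [IsLeft, h0, dir_zero] at h

lemma two_mul_card_isLeft (i : ZMod k) :
    2 * (Finset.univ.filter fun j => IsLeft j i).card + 1 ≤ k := by
  have h1 : (Finset.univ.filter fun j => IsLeft j i).card =
      (Finset.univ.filter fun j => IsLeft i j).card := by
    refine Finset.card_bij (fun j _ => i + (i - j)) ?_ ?_ ?_
    · intro j hj
      simp only [Finset.mem_filter, Finset.mem_univ, true_and] at hj ⊢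
      simp only [IsLeft] at hj ⊢
      rwa [add_sub_cancel_left]
    · intro a _ b _ h
      simpa using h
    · intro b hb
      refine ⟨i + (i - b), ?_, by ring⟩
      simp only [Finset.mem_filter, Finset.mem_univ, true_and] at hb ⊢
      simp only [IsLeft] at hb ⊢
      rwa [sub_add_cancel_left, neg_sub]
  have h2 : Disjoint (Finset.univ.filter fun j => IsLeft j i)
      (Finset.univ.filter fun j => IsLeft i j) := by
    rw [Finset.disjoint_filter]
    intro j _ hj hj'
    rw [isLeft_swap] at hj
    exact lt_asymm hj hj'
  have h3 : i ∉ (Finset.univ.filter fun j => IsLeft j i) ∪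
      (Finset.univ.filter fun j => IsLeft i j) := by
    simp only [Finset.mem_union, Finset.mem_filter, Finset.mem_univ, true_and, or_self]
    exact fun h => h.ne (sub_self i)
  have h4 := Finset.card_lt_univ_of_notMem h3
  rw [Finset.card_union_of_disjoint h2, ZMod.card] at h4
  omega

end Frame

/-! ### The arrangement -/

section Frame

variable {k : ℕ} [NeZero k] {ε : ℝ} {S : Finset (Option (ZMod k × Fin 6))} {i : ZMod k}

lemma NoLeft.snd_neg (hk : Odd k) (h : NoLeft IsLeft S i) {j : ZMod k} {n : Fin 6}
    (hj : some (j, n) ∈ S) (hji : j ≠ i) : (dir (j - i)).2 < 0 :=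
  isLeft_swap.1 ((isLeft_or hk hji.symm).resolve_left (h j n hj))

lemma NoRight.snd_pos (hk : Odd k) (h : NoRight IsLeft S i) {j : ZMod k} {n : Fin 6}
    (hj : some (j, n) ∈ S) (hji : j ≠ i) : 0 < (dir (j - i)).2 :=
  (isLeft_or hk hji.symm).resolve_right (h j n hj)

lemma NoLeft.of_not_exists (h : ¬ ∃ j n, some (j, n) ∈ S ∧ IsLeft i j) : NoLeft IsLeft S i :=
  fun j n hj hl => h ⟨j, n, hj, hl⟩

lemma NoRight.of_not_exists (h : ¬ ∃ j n, some (j, n) ∈ S ∧ IsLeft j i) : NoRight IsLeft S i :=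
  fun j n hj hl => h ⟨j, n, hj, hl⟩

lemma ne_of_isLeft {j : ZMod k} {m n : Fin 6} (h : IsLeft i j) :
    (some (j, m) : Option (ZMod k × Fin 6)) ≠ some (i, n) := by
  rintro h'
  simp only [Option.some.injEq, Prod.mk.injEq] at h'
  exact h.ne (sub_eq_zero.2 h'.1)

lemma ne_of_isLeft' {j : ZMod k} {m n : Fin 6} (h : IsLeft j i) :
    (some (j, m) : Option (ZMod k × Fin 6)) ≠ some (i, n) := (ne_of_isLeft h).symm

namespace Generic

lemma side_left (G : Generic k ε) {j : ZMod k} (h : IsLeft i j) {m n : Fin 6}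
    (hmn : depth m < depth n) (l : Fin 6) :
    orientDet (localPoint ε m) (localPoint ε n) (groupPoint ε (j - i) l) < 0 := by
  have := G.side (j - i) m n l h.ne hmn
  rw [neg_mul, ← mul_neg] at this
  have := (pos_iff_pos_of_mul_pos this).1 h
  linarith

lemma side_right (G : Generic k ε) {j : ZMod k} (h : IsLeft j i) {m n : Fin 6}
    (hmn : depth m < depth n) (l : Fin 6) :
    0 < orientDet (localPoint ε m) (localPoint ε n) (groupPoint ε (j - i) l) := by
  have h1 := isLeft_swap.1 h
  have h2 := G.side (j - i) m n l (by rw [← neg_sub]; exact neg_ne_zero.2 h.ne) hmn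
  exact (pos_iff_pos_of_mul_pos h2).1 (neg_pos.2 h1)

lemma ext_top (G : Generic k ε) (n : Fin 6) (hn : some (i, n) ∈ S)
    (hm : ∀ m < n, some (i, m) ∉ S) : IsExt (framePoint ε 0) S (some (i, n)) := by
  have h0 := G.pos
  have h1 := G.small
  have h3 := pow_pos h0 3
  have h3' : ε ^ 3 < ε / 1000 := by
    have : ε ^ 2 < 1 / 1000 := by nlinarith
    nlinarith
  refine isExt_of_forall_lt i 1 ε hn ?_
  have hlow : ∀ m : Fin 6, 1 - 4 * ε - 15 * ε ^ 3 ≤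
      (localPoint ε m).1 + ε * (localPoint ε m).2 := by
    intro m
    fin_cases m <;> simp [localPoint, depth, offset] <;> nlinarith
  rintro (_ | ⟨j, m⟩) hu hne
  · have := hlow n
    simp only [framePoint_none, framePoint_self, Prod.fst_zero, Prod.snd_zero]
    linarith
  · by_cases hj : j = i
    · subst hj
      have hlt : n < m := by
        rcases lt_trichotomy m n with h | h | h
        · exact absurd hu (hm m h)
        · exact absurd (by rw [h]) hne
        · exact h
      simp only [framePoint_self]
      clear hm hu hn hne hlow
      fin_cases n <;> fin_cases m <;> simp at hlt <;>
        simp [localPoint, depth, offset] <;> nlinarith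
    · have h4 := G.front (j - i) m (sub_ne_zero.2 hj)
      have := hlow n
      rw [framePoint_some, framePoint_self]
      linarith

lemma two_sided (G : Generic k ε) {r n : Fin 6} (hr : r = 0 ∨ r = 2) (hrn : r < n)
    (hrS : some (i, r) ∈ S) (h : IsExt (framePoint ε 0) S (some (i, n))) :
    NoLeft IsLeft S i ∨ NoRight IsLeft S i := by
  have hd : depth r < depth n := by
    clear hrS h
    rcases hr with rfl | rfl <;> fin_cases n <;> simp at hrn <;> simp [depth] <;> norm_num
  by_contra! hcon
  have hl : ∃ j l, some (j, l) ∈ S ∧ IsLeft i j := by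
    by_contra h'; exact hcon.1 (.of_not_exists h')
  have hr' : ∃ j l, some (j, l) ∈ S ∧ IsLeft j i := by
    by_contra h'; exact hcon.2 (.of_not_exists h')
  obtain ⟨j, l, hj, hij⟩ := hl
  obtain ⟨j', l', hj', hij'⟩ := hr'
  refine h.not_mem_triangle i hrS hj hj' (by simpa using hrn.ne) (ne_of_isLeft hij)
    (ne_of_isLeft' hij') ?_ ?_ ?_
  · rw [framePoint_self, framePoint_self, framePoint_some]
    have := G.side_left hij hd l
    simp only [orientDet] at this ⊢
    linarith
  · rw [framePoint_self, framePoint_some, framePoint_some]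
    exact G.cross _ _ n l l' hij (isLeft_swap.1 hij')
  · rw [framePoint_self, framePoint_self, framePoint_some]
    have := G.side_right hij' hd l'
    simp only [orientDet] at this ⊢
    linarith

lemma ext_four (G : Generic k ε) (h0 : some (i, 0) ∈ S) (h5 : some (i, 5) ∈ S)
    (h : IsExt (framePoint ε 0) S (some (i, 4))) : NoLeft IsLeft S i := by
  intro j l hj hij
  refine h.not_mem_triangle i h0 hj h5 (by simp) (ne_of_isLeft hij) (by simp) ?_ ?_ ?_
  · rw [framePoint_self, framePoint_self, framePoint_some]
    have := G.side_left hij (m := 0) (n := 4) (by simp [depth]) l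
    simp only [orientDet] at this ⊢
    linarith
  · rw [framePoint_self, framePoint_self, framePoint_some]
    have := G.base (j - i) l hij.ne
    simp only [orientDet] at this ⊢
    linarith
  · simp [orientDet, localPoint, depth, offset]
    have := pow_pos G.pos 3
    nlinarith

lemma ext_five (G : Generic k ε) (h0 : some (i, 0) ∈ S) (h4 : some (i, 4) ∈ S)
    (h : IsExt (framePoint ε 0) S (some (i, 5))) : NoRight IsLeft S i := by
  intro j l hj hij
  refine h.not_mem_triangle i h0 h4 hj (by simp) (by simp) (ne_of_isLeft' hij) ?_ ?_ ?_
  · simp [orientDet, localPoint, depth, offset]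
    have := pow_pos G.pos 3
    nlinarith
  · rw [framePoint_self, framePoint_self, framePoint_some]
    have := G.base (j - i) l (by rw [← neg_sub]; exact neg_ne_zero.2 hij.ne)
    simp only [orientDet] at this ⊢
    linarith
  · rw [framePoint_self, framePoint_self, framePoint_some]
    have := G.side_right hij (m := 0) (n := 5) (by simp [depth]) l
    simp only [orientDet] at this ⊢
    linarith

lemma not_ext (G : Generic k ε) {n : Fin 6} (h0 : some (i, 0) ∈ S) (h4 : some (i, 4) ∈ S)
    (h5 : some (i, 5) ∈ S) (hn : n = 1 ∨ n = 2 ∨ n = 3) :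
    ¬ IsExt (framePoint ε 0) S (some (i, n)) := by
  intro h
  have := pow_pos G.pos 3
  refine h.not_mem_triangle i h0 h4 h5 ?_ ?_ ?_ ?_ ?_ ?_ <;>
    rcases hn with rfl | rfl | rfl <;> simp [orientDet, localPoint, depth, offset] <;> nlinarith

/-- In a group at the left end, a point is extremal if it maximizes the lateral offset plus a
suitable multiple of the depth. -/
lemma ext_of_noLeft (hk : Odd k) (G : Generic k ε) (hl : NoLeft IsLeft S i) (hz : none ∉ S)
    {n : Fin 6} (hn : some (i, n) ∈ S) {μ : ℝ} (hμ : μ ≤ 4)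
    (hpos : 0 ≤ offset n + μ * depth n)
    (hmax : ∀ m, some (i, m) ∈ S → m ≠ n →
      offset m + μ * depth m < offset n + μ * depth n) :
    IsExt (framePoint ε 0) S (some (i, n)) := by
  have h0 := G.pos
  have h2 := pow_pos h0 2
  refine isExt_of_forall_lt i (-(ε * μ)) 1 hn ?_
  rintro (_ | ⟨j, m⟩) hu hne
  · exact absurd hu hz
  · by_cases hj : j = i
    · subst hj
      have := hmax m hu (by rintro rfl; exact hne rfl)
      simp only [framePoint_self, localPoint]
      nlinarith
    · have hs := hl.snd_neg hk hu hj
      have h4 := G.below _ m hs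
      have h5 := G.fst_lt_one (j - i) m (sub_ne_zero.2 hj)
      rw [framePoint_some, framePoint_self]
      simp only [localPoint]
      have h6 := mul_nonneg h2.le hpos
      have h7 : 0 ≤ ε * (4 - μ) * (1 - (groupPoint ε (j - i) m).1) :=
        mul_nonneg (mul_nonneg h0.le (by linarith)) (by linarith)
      nlinarith

lemma ext_left (hk : Odd k) (G : Generic k ε) {n : Fin 6} (hl : NoLeft IsLeft S i)
    (hz : none ∉ S) (h4 : some (i, 4) ∉ S) (hn : n = 1 ∨ n = 3) (hS : some (i, n) ∈ S) :
    IsExt (framePoint ε 0) S (some (i, n)) := by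
  rcases hn with rfl | rfl
  · refine ext_of_noLeft hk G hl hz hS (μ := 3 / 2) (by norm_num)
      (by simp [offset, depth]; norm_num) ?_
    intro m hm hne
    have hm4 : m ≠ 4 := by rintro rfl; exact h4 hm
    clear hm
    fin_cases m <;> simp at hne hm4 <;> simp [offset, depth] <;> linarith
  · refine ext_of_noLeft hk G hl hz hS (μ := 4) (by norm_num)
      (by simp [offset, depth]; norm_num) ?_
    intro m hm hne
    have hm4 : m ≠ 4 := by rintro rfl; exact h4 hm
    clear hm
    fin_cases m <;> simp at hne hm4 <;> simp [offset, depth] <;> linarith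

lemma ext_left_four (hk : Odd k) (G : Generic k ε) (hl : NoLeft IsLeft S i)
    (hz : none ∉ S) (h4 : some (i, 4) ∈ S) : IsExt (framePoint ε 0) S (some (i, 4)) := by
  refine ext_of_noLeft hk G hl hz h4 (μ := 0) (by norm_num)
    (by simp [offset, depth]) ?_
  intro m _ hne
  fin_cases m <;> simp at hne <;> simp [offset, depth] <;> linarith

lemma ext_right (hk : Odd k) (G : Generic k ε) (hr : NoRight IsLeft S i)
    (h5 : some (i, 5) ∉ S) (h3 : some (i, 3) ∈ S) : IsExt (framePoint ε 0) S (some (i, 3)) := by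
  have h2 := pow_pos G.pos 2
  refine isExt_of_forall_lt i 0 (-1) h3 ?_
  rintro (_ | ⟨j, m⟩) hu hne
  · simp [localPoint, offset, G.pos]
  · by_cases hj : j = i
    · subst hj
      have hm5 : m ≠ 5 := by rintro rfl; exact h5 hu
      have hm3 : m ≠ 3 := by rintro rfl; exact hne rfl
      clear hu hne
      simp only [framePoint_self, localPoint]
      fin_cases m <;> simp at hm5 hm3 <;> simp [offset] <;> nlinarith
    · have := G.above _ m (hr.snd_pos hk hu hj)
      rw [framePoint_some, framePoint_self]
      simp only [localPoint, offset]
      simp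
      nlinarith

lemma ext_centre (hk : Odd k) (G : Generic k ε)
    (h : NoLeft IsLeft S i ∨ NoRight IsLeft S i) (hz : none ∈ S) :
    IsExt (framePoint ε 0) S none := by
  have h0 := G.pos
  have h1 := G.small
  have h2 := pow_pos h0 2
  have h3 : ε ^ 2 < ε / 1000 := by nlinarith
  rcases h with h | h
  · refine isExt_of_forall_lt i (-ε) 1 hz ?_
    rintro (_ | ⟨j, m⟩) hu hne
    · exact absurd rfl hne
    · by_cases hj : j = i
      · subst hj
        simp only [framePoint_self, localPoint]
        clear hu hne
        fin_cases m <;> simp [offset, depth] <;> nlinarith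
      · have := G.tilt_right _ m (h.snd_neg hk hu hj)
        simp only [framePoint_some, framePoint_none, Prod.fst_zero, Prod.snd_zero]
        linarith
  · refine isExt_of_forall_lt i (-ε) (-1) hz ?_
    rintro (_ | ⟨j, m⟩) hu hne
    · exact absurd rfl hne
    · by_cases hj : j = i
      · subst hj
        simp only [framePoint_self, localPoint]
        clear hu hne
        fin_cases m <;> simp [offset, depth] <;> nlinarith
      · have := G.tilt_left _ m (h.snd_pos hk hu hj)
        simp only [framePoint_some, framePoint_none, Prod.fst_zero, Prod.snd_zero]
        linarith


lemma exists_noLeft (G : Generic k ε) (hz : IsExt (framePoint ε 0) (insert none S) none)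
    (hS : ∃ i n, some (i, n) ∈ S) : ∃ i n, some (i, n) ∈ S ∧ NoLeft IsLeft S i := by
  obtain ⟨f, c, hf0, hf⟩ := geometric_hahn_banach_point_closed (convex_convexHull ℝ _)
    ((((insert none S).erase none).finite_toSet.image (framePoint ε 0)).isClosed_convexHull ℝ) hz.2
  rw [framePoint_none, map_zero] at hf0
  have hfS : ∀ i n, some (i, n) ∈ S → 0 < f (framePoint ε 0 (some (i, n))) := by
    intro i n h
    refine hf0.trans (hf _ (subset_convexHull _ _ (Set.mem_image_of_mem _ ?_)))
    simpa using h
  set α := f (1, 0)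
  set β := f (0, 1)
  have hfe : ∀ p : ℝ × ℝ, f p = α * p.1 + β * p.2 := by
    intro p
    have : p = p.1 • ((1, 0) : ℝ × ℝ) + p.2 • ((0, 1) : ℝ × ℝ) := by ext <;> simp
    rw [this, map_add, map_smul, map_smul]
    simp [α, β]
    ring
  have hne : (S.erase none).Nonempty := by
    obtain ⟨i, n, h⟩ := hS
    exact ⟨some (i, n), by simpa using h⟩
  obtain ⟨v, hv, hmax⟩ := Finset.exists_max_image (S.erase none) (fun u =>
    (α * (framePoint ε 0 u).2 - β * (framePoint ε 0 u).1) / f (framePoint ε 0 u)) hne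
  rcases v with _ | ⟨i, n⟩
  · simp at hv
  have hiS : some (i, n) ∈ S := Finset.mem_of_mem_erase hv
  refine ⟨i, n, hiS, fun j m hj hij => ?_⟩
  have h1 := hmax (some (j, m)) (by simpa using hj)
  have h2 := G.centre (j - i) n m hij.ne
  have h3 := (pos_iff_pos_of_mul_pos h2).1 hij
  have h4 := orientDet_framePoint ε i none (some (i, n)) (some (j, m))
  rw [framePoint_none, framePoint_none, framePoint_self, framePoint_some ε i] at h4
  rw [← h4] at h3
  have hp := hfS i n hiS
  have hq := hfS j m hj
  rw [div_le_div_iff₀ hq hp, hfe, hfe] at h1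
  rw [hfe] at hp
  simp only [orientDet, Prod.fst_zero, Prod.snd_zero, sub_zero] at h3
  have h5 : 0 < α ^ 2 + β ^ 2 := by
    by_contra! h
    have ha : α = 0 := by nlinarith [sq_nonneg α, sq_nonneg β]
    have hb : β = 0 := by nlinarith [sq_nonneg α, sq_nonneg β]
    rw [ha, hb] at hp
    linarith
  nlinarith [mul_pos h5 h3]

lemma arrangement_of_injective (hk : Odd k) (G : Generic k ε)
    (hinj : Function.Injective (framePoint ε (0 : ZMod k))) :
    Arrangement (framePoint ε (0 : ZMod k)) IsLeft where
  inj := hinj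
  left_or _ _ := isLeft_or hk
  count := two_mul_card_isLeft
  ext_top _ _ n := G.ext_top n
  two_sided _ _ _ _ := G.two_sided
  ext_four _ _ := G.ext_four
  ext_five _ _ := G.ext_five
  not_ext _ _ _ := G.not_ext
  ext_left _ _ _ := G.ext_left hk
  ext_left_four _ _ := G.ext_left_four hk
  ext_right _ _ := G.ext_right hk
  ext_centre _ _ _ _ := G.ext_centre hk
  exists_noLeft _ := G.exists_noLeft

/-! ### General position -/

lemma det_centre_ne_zero (G : Generic k ε) {i j : ZMod k} {n m : Fin 6}
    (h : (some (i, n) : Option (ZMod k × Fin 6)) ≠ some (j, m)) :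
    orientDet (framePoint ε (0 : ZMod k) none) (framePoint ε 0 (some (i, n)))
      (framePoint ε 0 (some (j, m))) ≠ 0 := by
  rw [orientDet_framePoint ε i]
  by_cases hj : j = i
  · subst hj
    have hnm : n ≠ m := by rintro rfl; exact h rfl
    intro h0
    have h1 : ε ^ 2 * (offset m - offset n + ε * (depth m * offset n - depth n * offset m)) =
        0 := by
      simp only [framePoint_self, framePoint_none, orientDet, localPoint, Prod.fst_zero,
        Prod.snd_zero] at h0
      linear_combination h0
    have h2 := (mul_eq_zero.1 h1).resolve_left (pow_pos G.pos 2).ne'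
    have h3 := G.pos
    have h4 := G.small
    clear h h0 h1
    fin_cases n <;> fin_cases m <;> simp at hnm <;> simp [offset, depth] at h2 <;> linarith
  · have := G.centre (j - i) n m (sub_ne_zero.2 hj)
    rw [framePoint_none, framePoint_self, framePoint_some]
    exact (right_ne_zero_of_mul this.ne')

lemma det_pair_ne_zero (G : Generic k ε) {i j : ZMod k} {n m : Fin 6} (hij : i ≠ j)
    (hnm : n ≠ m) (l : Fin 6) :
    orientDet (framePoint ε 0 (some (i, n))) (framePoint ε 0 (some (i, m)))
      (framePoint ε 0 (some (j, l))) ≠ 0 := by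
  rw [orientDet_framePoint ε i, framePoint_self, framePoint_self, framePoint_some]
  have hj : j - i ≠ 0 := sub_ne_zero.2 hij.symm
  have hswap : ∀ p q r : ℝ × ℝ, orientDet p q r = -orientDet q p r := by
    intro p q r; simp only [orientDet]; ring
  rcases lt_trichotomy (depth n) (depth m) with h | h | h
  · exact right_ne_zero_of_mul (G.side (j - i) n m l hj h).ne'
  · have hcase : n = 5 ∧ m = 4 ∨ n = 4 ∧ m = 5 := by
      fin_cases n <;> fin_cases m <;> simp at hnm <;> simp [depth] at h ⊢
    have hb := (G.base (j - i) l hj).ne'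
    rcases hcase with ⟨rfl, rfl⟩ | ⟨rfl, rfl⟩
    · exact hb
    · rw [hswap]
      exact neg_ne_zero.2 hb
  · rw [hswap]
    exact neg_ne_zero.2 (right_ne_zero_of_mul (G.side (j - i) m n l hj h).ne')

lemma det_group_ne_zero (G : Generic k ε) (i : ZMod k) {n m l : Fin 6} (hnm : n ≠ m)
    (hnl : n ≠ l) (hml : m ≠ l) :
    orientDet (framePoint ε 0 (some (i, n))) (framePoint ε 0 (some (i, m)))
      (framePoint ε 0 (some (i, l))) ≠ 0 := by
  rw [orientDet_framePoint ε i, framePoint_self, framePoint_self, framePoint_self]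
  have h : orientDet (localPoint ε n) (localPoint ε m) (localPoint ε l) = ε ^ 3 *
      ((offset m - offset n) * (depth l - depth n) -
        (depth m - depth n) * (offset l - offset n)) := by
    simp only [orientDet, localPoint]
    ring
  rw [h]
  refine mul_ne_zero (pow_pos G.pos 3).ne' ?_
  clear h
  fin_cases n <;> fin_cases m <;> simp at hnm <;> fin_cases l <;> simp at hnl hml <;>
    simp [offset, depth] <;> norm_num

lemma det_ne_zero (G : Generic k ε) {u v w : Option (ZMod k × Fin 6)} (huv : u ≠ v)
    (huw : u ≠ w) (hvw : v ≠ w) :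
    orientDet (framePoint ε 0 u) (framePoint ε 0 v) (framePoint ε 0 w) ≠ 0 := by
  have hrot : ∀ p q r : ℝ × ℝ, orientDet p q r = orientDet q r p := by
    intro p q r; simp only [orientDet]; ring
  rcases u with _ | ⟨i, n⟩ <;> rcases v with _ | ⟨j, m⟩ <;> rcases w with _ | ⟨l, o⟩ <;>
    try exact absurd rfl ‹_›
  · exact G.det_centre_ne_zero hvw
  · rw [hrot]
    exact G.det_centre_ne_zero huw.symm
  · rw [hrot, hrot]
    exact G.det_centre_ne_zero huv
  · by_cases hij : i = j
    · subst hij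
      have hnm : n ≠ m := by rintro rfl; exact huv rfl
      by_cases hil : i = l
      · subst hil
        exact G.det_group_ne_zero i hnm (by rintro rfl; exact huw rfl)
          (by rintro rfl; exact hvw rfl)
      · exact G.det_pair_ne_zero hil hnm o
    · by_cases hjl : j = l
      · subst hjl
        rw [hrot]
        exact G.det_pair_ne_zero (Ne.symm hij) (by rintro rfl; exact hvw rfl) n
      · by_cases hil : i = l
        · subst hil
          rw [hrot, hrot]
          exact G.det_pair_ne_zero hij (by rintro rfl; exact huw rfl) m
        · rw [orientDet_framePoint ε l, framePoint_self, framePoint_some, framePoint_some]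
          exact G.distinct _ _ o n m (sub_ne_zero.2 hil) (sub_ne_zero.2 hjl)
            (fun h => hij (sub_left_injective h))

lemma injective_framePoint (G : Generic k ε) :
    Function.Injective (framePoint ε (0 : ZMod k)) := by
  intro u v h
  by_contra huv
  obtain ⟨w, -, hw⟩ := Finset.exists_mem_notMem_of_card_lt_card
    (s := {u, v}) (t := ({none, some (0, 0), some (0, 1)} : Finset (Option (ZMod k × Fin 6))))
    (lt_of_le_of_lt Finset.card_le_two (by simp))
  simp only [Finset.mem_insert, Finset.mem_singleton, not_or] at hw
  refine G.det_ne_zero huv (Ne.symm hw.1) (Ne.symm hw.2) ?_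
  rw [h]
  simp [orientDet]

end Generic

end Frame

/-! ### The first move -/

lemma exists_apex (B : Finset (ℝ × ℝ)) : ∃ p : ℝ × ℝ, (∀ q ∈ B, q.1 < p.1) ∧
    ∀ q ∈ B, ∀ r ∈ B, q ≠ r → orientDet q r p ≠ 0 := by
  obtain ⟨t, ht⟩ : ∃ t : ℝ, ∀ q ∈ B, q.1 < t := by
    obtain ⟨M, hM⟩ := (B.image Prod.fst).bddAbove
    exact ⟨M + 1, fun q hq => (hM (Finset.mem_coe.2 (Finset.mem_image_of_mem _ hq))).trans_lt
      (lt_add_one M)⟩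
  obtain ⟨y, hy⟩ := Infinite.exists_notMem_finset ((B ×ˢ B).image fun x : (ℝ × ℝ) × (ℝ × ℝ) =>
    x.1.2 + (x.2.2 - x.1.2) * (t - x.1.1) / (x.2.1 - x.1.1))
  refine ⟨(t, y), ht, fun q hq r hr hqr h0 => ?_⟩
  simp only [orientDet] at h0
  by_cases h : r.1 - q.1 = 0
  · rw [h, zero_mul, zero_sub, neg_eq_zero] at h0
    have h1 : r.2 - q.2 = 0 := (mul_eq_zero.1 h0).resolve_right (sub_pos.2 (ht q hq)).ne'
    exact hqr (Prod.ext (sub_eq_zero.1 h).symm (sub_eq_zero.1 h1).symm)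
  · refine hy (Finset.mem_image.2 ⟨(q, r), Finset.mem_product.2 ⟨hq, hr⟩, ?_⟩)
    field_simp
    linarith

lemma mem_exPts_of_fst_lt {C : Finset (ℝ × ℝ)} {p : ℝ × ℝ} (hp : p ∈ C)
    (h : ∀ q ∈ C.erase p, q.1 < p.1) : p ∈ exPts C := by
  refine mem_exPts.2 ⟨hp, fun hc => ?_⟩
  have hsub : (↑(C.erase p) : Set (ℝ × ℝ)) ⊆ {q | q.1 < p.1} := fun q hq =>
    Set.mem_ofPred_eq ▸ h q hq
  exact lt_irrefl _ (Set.mem_ofPred_eq ▸ convexHull_min hsub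
    (convex_halfSpace_lt (𝕜 := ℝ) ⟨fun _ _ => rfl, fun _ _ => rfl⟩ _) hc)

lemma genPos_insert {B : Finset (ℝ × ℝ)} {p : ℝ × ℝ} (hB : GenPos (↑B : Set (ℝ × ℝ)))
    (hp : ∀ q ∈ B, ∀ r ∈ B, q ≠ r → orientDet q r p ≠ 0) :
    GenPos (↑(insert p B) : Set (ℝ × ℝ)) := by
  have hrot : ∀ p q r : ℝ × ℝ, orientDet p q r = orientDet q r p := by
    intro p q r; simp only [orientDet]; ring
  intro a ha b hb c hc hab hac hbc
  rcases Finset.mem_insert.1 (Finset.mem_coe.1 ha) with rfl | ha' <;>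
    rcases Finset.mem_insert.1 (Finset.mem_coe.1 hb) with rfl | hb' <;>
    rcases Finset.mem_insert.1 (Finset.mem_coe.1 hc) with rfl | hc' <;>
    try exact absurd rfl ‹_›
  · rw [hrot]
    exact hp b hb' c hc' hbc
  · rw [hrot, hrot]
    exact hp c hc' a ha' hac.symm
  · exact hp a ha' b hb' hab
  · exact hB a (Finset.mem_coe.2 ha') b (Finset.mem_coe.2 hb') c (Finset.mem_coe.2 hc') hab hac hbc

lemma card_isRed {k : ℕ} [NeZero k] :
    (Finset.univ.filter fun v : Option (ZMod k × Fin 6) => IsRed v).card = 2 * k := by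
  have h : (Finset.univ.filter fun v : Option (ZMod k × Fin 6) => IsRed v) =
      ((Finset.univ : Finset (ZMod k)) ×ˢ ({1, 3} : Finset (Fin 6))).map
        Function.Embedding.some := by
    ext v
    rw [Finset.mem_filter]
    rcases v with _ | ⟨i, n⟩ <;> simp [IsRed]
  rw [h, Finset.card_map, Finset.card_product, Finset.card_univ, ZMod.card]
  simp [mul_comm]

/-- For every odd `k > 2` there is an even-sized cake `𝒞` with
`R(𝒞) = 2k + 1` and `M(𝒞) ≤ (1/4)·R(𝒞) + 1/4 = (k + 1)/2`
(stated as `2·M(𝒞) ≤ k + 1`). -/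
theorem statement9 (k : ℕ) (hodd : Odd k) (hk : 2 < k) :
    ∃ (C : Finset (ℝ × ℝ)) (w : ℝ × ℝ → ℕ),
      (∀ p, w p ≤ 1) ∧ GenPos (↑C : Set (ℝ × ℝ)) ∧ Even C.card ∧
      (C.filter (fun p => w p = 1)).card = 2 * k + 1 ∧
      2 * gameM w C ≤ k + 1 := by
  have : NeZero k := ⟨by omega⟩
  obtain ⟨ε, G⟩ := exists_generic hodd
  have hinj := G.injective_framePoint
  have A := G.arrangement_of_injective hodd hinj
  set pt := framePoint ε (0 : ZMod k)
  set B := Finset.univ.image pt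
  obtain ⟨p, hp, hpB⟩ := exists_apex B
  have hpnot : p ∉ B := fun h => lt_irrefl _ (hp p h)
  let w : ℝ × ℝ → ℕ := fun q => if q = p ∨ ∃ v, IsRed v ∧ pt v = q then 1 else 0
  have hw : ∀ v, w (pt v) = if IsRed v then 1 else 0 := by
    intro v
    have h1 : pt v ≠ p := fun h => hpnot (h ▸ Finset.mem_image_of_mem _ (Finset.mem_univ v))
    have h2 : (∃ u, IsRed u ∧ pt u = pt v) ↔ IsRed v :=
      ⟨fun ⟨u, hu, h⟩ => hinj h ▸ hu, fun h => ⟨v, h, rfl⟩⟩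
    simp only [w, h1, false_or, h2]
  have hBcard : B.card = 6 * k + 1 := by
    rw [Finset.card_image_of_injective _ hinj, Finset.card_univ, Fintype.card_option,
      Fintype.card_prod, ZMod.card, Fintype.card_fin, mul_comm]
  refine ⟨insert p B, w, fun q => ?_, genPos_insert ?_ hpB, ?_, ?_, ?_⟩
  · simp only [w]
    split_ifs <;> simp
  · intro a ha b hb c hc hab hac hbc
    obtain ⟨u, -, rfl⟩ := Finset.mem_image.1 (Finset.mem_coe.1 ha)
    obtain ⟨v, -, rfl⟩ := Finset.mem_image.1 (Finset.mem_coe.1 hb)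
    obtain ⟨x, -, rfl⟩ := Finset.mem_image.1 (Finset.mem_coe.1 hc)
    exact G.det_ne_zero (ne_of_apply_ne _ hab) (ne_of_apply_ne _ hac) (ne_of_apply_ne _ hbc)
  · rw [Finset.card_insert_of_notMem hpnot, hBcard]
    exact ⟨3 * k + 1, by ring⟩
  · have hred : B.filter (fun q => w q = 1) = (Finset.univ.filter fun v => IsRed v).image pt := by
      ext q
      simp only [B, Finset.mem_filter, Finset.mem_image, Finset.mem_univ, true_and]
      constructor
      · rintro ⟨⟨v, rfl⟩, h⟩
        rw [hw] at h
        exact ⟨v, by simpa using h, rfl⟩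
      · rintro ⟨v, h, rfl⟩
        exact ⟨⟨v, rfl⟩, by rw [hw, if_pos h]⟩
    rw [Finset.filter_insert, if_pos (by simp [w]), Finset.card_insert_of_notMem
      (fun h => hpnot (Finset.mem_filter.1 h).1), hred, Finset.card_image_of_injective _ hinj,
      card_isRed]
  · have h1 : gameM w (insert p B) ≤ gameMB w B := by
      have h := gameM_le_gameMB_erase (w := w) (mem_exPts_of_fst_lt (Finset.mem_insert_self p B)
        (by rw [Finset.erase_insert hpnot]; exact hp))
      rwa [Finset.erase_insert hpnot] at h
    have h2 : gameMB w B ≤ (k + 1) / 2 :=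
      A.gameMB_le_of_isStaircase hw _ _ rfl
        ⟨Finset.mem_univ _, fun i => ⟨0, by simp, fun n => by simp⟩⟩
    omega

end
end
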